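/- arXiv:1207.1802 — 2 statements merged into one kernel-verified Lean document; each statement's English description precedes it below -/
import Mathlib

section
/- For every integer h ≥ 2, there are only finitely many integral trees (up to isomorphism) whose adjacency matrix has nullity exactly h. -/
open scoped Classical

/-- Characteristic polynomial of the adjacency matrix of a graph. -/
noncomputable def gCharpoly {V : Type*} [Fintype V] (G : SimpleGraph V) : Polynomial ℝ :=
  letI := Classical.decEq V
  letI := Classical.decRel G.Adj
  (G.adjMatrix ℝ).charpoly

/-- Adjacency eigenvalues listed in non-increasing order (with multiplicity). -/
noncomputable def eigsDesc {V : Type*} [Fintype V] (G : SimpleGraph V) : List ℝ :=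
  ((gCharpoly G).roots.sort (· ≤ ·)).reverse

/-- Number of adjacency eigenvalues in the open interval (-1, 1), with multiplicity. -/
noncomputable def numIn {V : Type*} [Fintype V] (G : SimpleGraph V) : ℕ :=
  ((gCharpoly G).roots.filter (fun x => -1 < x ∧ x < 1)).card

/-- Multiplicity of `lam` as an adjacency eigenvalue. -/
noncomputable def multOf {V : Type*} [Fintype V] (G : SimpleGraph V) (lam : ℝ) : ℕ :=
  (gCharpoly G).roots.count lam

/-- Nullity: dimension of the kernel of the adjacency matrix. -/
noncomputable def gNullity {V : Type*} [Fintype V] (G : SimpleGraph V) : ℕ :=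
  letI := Classical.decRel G.Adj
  Module.finrank ℝ (LinearMap.ker (G.adjMatrix ℝ).mulVecLin)

/-- A graph is integral if all of its adjacency eigenvalues are integers. -/
def GraphIntegral {V : Type*} [Fintype V] (G : SimpleGraph V) : Prop :=
  ∀ x ∈ (gCharpoly G).roots, ∃ z : ℤ, (z : ℝ) = x

namespace IT

/-- Action of the adjacency matrix. -/
noncomputable def Aop {V : Type*} [Fintype V] (G : SimpleGraph V) (x : V → ℝ) (v : V) : ℝ :=
  ∑ u ∈ Finset.univ.filter (fun u => G.Adj v u), x u

/-- Integral spectral decomposition of the adjacency operator. -/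
structure Spec {V : Type*} [Fintype V] (G : SimpleGraph V) (h : ℕ) where
  lam : V → ℤ
  u : V → V → ℝ
  orth : ∀ i j, ∑ v, u i v * u j v = if i = j then 1 else 0
  pars : ∀ x y : V → ℝ,
    ∑ i, (∑ v, u i v * x v) * (∑ v, u i v * y v) = ∑ v, x v * y v
  eig : ∀ i v, Aop G (u i) v = lam i * u i v
  null : (Finset.univ.filter (fun i => lam i = 0)).card = h

theorem Aop_eq_mulVec {V : Type*} [Fintype V] (G : SimpleGraph V) (x : V → ℝ) :
    Aop G x = (G.adjMatrix ℝ).mulVec x := by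
  funext v
  rw [SimpleGraph.adjMatrix_mulVec_apply]
  unfold Aop
  refine Finset.sum_congr ?_ fun _ _ => rfl
  ext u
  simp

theorem exists_spec {V : Type*} [Fintype V] (G : SimpleGraph V) (h : ℕ)
    (hint : GraphIntegral G) (hn : gNullity G = h) : Nonempty (Spec G h) := by
  have hA : (G.adjMatrix ℝ).IsHermitian := by
    rw [Matrix.IsHermitian, Matrix.conjTranspose_eq_transpose_of_trivial]
    exact G.transpose_adjMatrix
  have hz : ∀ i, ∃ z : ℤ, (z : ℝ) = hA.eigenvalues i := by
    intro i
    apply hint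
    unfold gCharpoly
    have := hA.roots_charpoly_eq_eigenvalues
    have h2 : hA.eigenvalues i ∈ (G.adjMatrix ℝ).charpoly.roots := by
      rw [this]
      simp
    convert h2
  choose lam hlam using hz
  refine ⟨⟨lam, fun i v => hA.eigenvectorBasis i v, ?_, ?_, ?_, ?_⟩⟩
  · intro i j
    have := (orthonormal_iff_ite.mp hA.eigenvectorBasis.orthonormal) i j
    rw [PiLp.inner_apply] at this
    rw [← this]
    refine Finset.sum_congr rfl fun v _ => ?_
    simp [mul_comm]
  · intro x y
    have := hA.eigenvectorBasis.sum_inner_mul_inner (WithLp.toLp 2 x) (WithLp.toLp 2 y)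
    rw [PiLp.inner_apply] at this
    simp only [PiLp.inner_apply] at this
    simp only [RCLike.inner_apply, conj_trivial] at this
    rw [show ∑ v, x v * y v = ∑ v, y v * x v from Finset.sum_congr rfl fun v _ => mul_comm _ _]
    rw [← this]
    refine Finset.sum_congr rfl fun i _ => ?_
    congr 1
    refine Finset.sum_congr rfl fun v _ => mul_comm _ _
  · intro i v
    rw [Aop_eq_mulVec, hlam]
    have := congrFun (hA.mulVec_eigenvectorBasis i) v
    simpa using this
  · have h1 := hA.rank_eq_card_non_zero_eigs
    have h2 := (G.adjMatrix ℝ).mulVecLin.finrank_range_add_finrank_ker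
    rw [Module.finrank_fintype_fun_eq_card] at h2
    have h3 : Module.finrank ℝ (LinearMap.ker (G.adjMatrix ℝ).mulVecLin) = h := by
      rw [← hn]; unfold gNullity; congr!
    change (G.adjMatrix ℝ).rank + _ = _ at h2
    rw [h3, h1, Fintype.card_subtype] at h2
    have h4 := Finset.card_filter_add_card_filter_not (s := (Finset.univ : Finset V))
      (fun i => hA.eigenvalues i ≠ 0)
    rw [Finset.card_univ] at h4
    have h5 : (Finset.univ.filter (fun i => lam i = 0))
        = Finset.univ.filter (fun i => ¬ hA.eigenvalues i ≠ 0) := by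
      ext i
      simp only [Finset.mem_filter, Finset.mem_univ, true_and, not_not]
      rw [← hlam]; norm_cast
    rw [h5]
    omega

/-- The consequences of the spectral decomposition that are used. -/
structure Facts {V : Type*} [Fintype V] (G : SimpleGraph V) (h : ℕ) : Prop where
  mass : ∃ w : V → ℝ, (∀ v, 0 ≤ w v) ∧ ∑ v, w v = h ∧
    (∀ x : V → ℝ, ∑ v, x v ^ 2 - ∑ v, Aop G x v ^ 2 ≤
      (∑ v, x v ^ 2) * ∑ v ∈ Finset.univ.filter (fun v => x v ≠ 0), w v) ∧
    (∀ z : V → ℝ, (∀ v, Aop G z v = 0) → ∀ v, z v ^ 2 ≤ w v * ∑ v, z v ^ 2)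
  nullv : ∀ x : V → ℝ, ∑ v, Aop G x v ^ 2 < ∑ v, x v ^ 2 →
    ∃ z : V → ℝ, (∀ v, Aop G z v = 0) ∧ ∑ v, z v * x v ≠ 0
  gap : ∀ (x : V → ℝ) (j : ℤ), 0 ≤ ∑ v, Aop G x v ^ 2 - (2 * j + 1) * ∑ v, x v * Aop G x v
    + j * (j + 1) * ∑ v, x v ^ 2
  top : ∀ j : ℤ, (∃ L : ℤ, j + 1 ≤ L ∧ ∃ z : V → ℝ, z ≠ 0 ∧ ∀ v, Aop G z v = L * z v) ∨
    (∀ x : V → ℝ, ∑ v, x v * Aop G x v = j * ∑ v, x v ^ 2 → ∀ v, Aop G x v = j * x v)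
  two : 2 ≤ h → ∀ s, ∃ z : V → ℝ, z ≠ 0 ∧ (∀ v, Aop G z v = 0) ∧ z s = 0

theorem Aop_symm {V : Type*} [Fintype V] (G : SimpleGraph V) (x y : V → ℝ) :
    ∑ v, Aop G x v * y v = ∑ v, x v * Aop G y v := by
  unfold Aop
  simp_rw [Finset.sum_filter, Finset.sum_mul, Finset.mul_sum]
  rw [Finset.sum_comm]
  refine Finset.sum_congr rfl fun v _ => Finset.sum_congr rfl fun u _ => ?_
  by_cases hh : G.Adj v u
  · simp [hh, hh.symm]
  · have : ¬ G.Adj u v := fun h => hh h.symm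
    simp [hh, this]

theorem Spec.facts {V : Type*} [Fintype V] {G : SimpleGraph V} {h : ℕ} (S : Spec G h) :
    Facts G h := by
  obtain ⟨lam, u, orth, pars, eig, null⟩ := S
  set c : (V → ℝ) → V → ℝ := fun x i => ∑ v, u i v * x v with hc
  have hcA : ∀ x i, c (Aop G x) i = lam i * c x i := by
    intro x i
    simp only [hc]
    rw [← Aop_symm, Finset.mul_sum]
    refine Finset.sum_congr rfl fun v _ => ?_
    rw [eig]; ring
  have p1 : ∀ x, ∑ v, x v ^ 2 = ∑ i, c x i ^ 2 := by
    intro x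
    have := pars x x
    simp only [pow_two, hc]
    exact this.symm
  have p2 : ∀ x, ∑ v, Aop G x v ^ 2 = ∑ i, (lam i : ℝ) ^ 2 * c x i ^ 2 := by
    intro x
    rw [p1]
    refine Finset.sum_congr rfl fun i _ => ?_
    rw [hcA]; ring
  have p3 : ∀ x, ∑ v, x v * Aop G x v = ∑ i, (lam i : ℝ) * c x i ^ 2 := by
    intro x
    have := pars x (Aop G x)
    rw [← this]
    refine Finset.sum_congr rfl fun i _ => ?_
    have := hcA x i
    simp only [hc] at this ⊢
    rw [this]; ring
  have hN : ∀ x, ∑ v, x v ^ 2 - ∑ v, Aop G x v ^ 2 ≤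
      ∑ i ∈ Finset.univ.filter (fun i => lam i = 0), c x i ^ 2 := by
    intro x
    rw [p2, p1, ← Finset.sum_sub_distrib, Finset.sum_filter]
    refine Finset.sum_le_sum fun i _ => ?_
    by_cases hi : lam i = 0
    · simp [hi]
    · simp only [hi, if_false]
      have h1 : (1 : ℤ) ≤ lam i ^ 2 := by
        have := sq_pos_of_ne_zero hi; omega
      have h2 : (1 : ℝ) ≤ (lam i : ℝ) ^ 2 := by exact_mod_cast h1
      nlinarith [sq_nonneg (c x i)]
  have hnull : ∀ i, lam i = 0 → ∀ v, Aop G (u i) v = 0 := by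
    intro i hi v
    rw [eig, hi]; simp
  refine ⟨⟨fun v => ∑ i ∈ Finset.univ.filter (fun i => lam i = 0), u i v ^ 2, ?_, ?_, ?_, ?_⟩,
    ?_, ?_, ?_, ?_⟩
  · intro v; positivity
  · rw [Finset.sum_comm]
    have : ∀ i ∈ Finset.univ.filter (fun i => lam i = 0), ∑ v, u i v ^ 2 = 1 := by
      intro i _
      have := orth i i
      simp only [if_true] at this
      simp only [pow_two]; exact this
    rw [Finset.sum_congr rfl this]
    simp [null]
  · intro x
    refine (hN x).trans ?_
    rw [Finset.sum_comm, Finset.mul_sum]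
    refine Finset.sum_le_sum fun i _ => ?_
    have h1 : c x i = ∑ v ∈ Finset.univ.filter (fun v => x v ≠ 0), u i v * x v := by
      simp only [hc]
      rw [Finset.sum_filter]
      refine Finset.sum_congr rfl fun v _ => ?_
      by_cases hv : x v = 0 <;> simp [hv]
    have h2 : ∑ v, x v ^ 2 = ∑ v ∈ Finset.univ.filter (fun v => x v ≠ 0), x v ^ 2 := by
      rw [Finset.sum_filter]
      refine Finset.sum_congr rfl fun v _ => ?_
      by_cases hv : x v = 0 <;> simp [hv]
    rw [h1, h2, mul_comm]
    exact Finset.sum_mul_sq_le_sq_mul_sq _ _ _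
  · intro z hz v
    have hci : ∀ i, lam i ≠ 0 → c z i = 0 := by
      intro i hi
      have := hcA z i
      have h0 : c (Aop G z) i = 0 := by
        simp only [hc]
        refine Finset.sum_eq_zero fun v _ => ?_
        rw [hz]; simp
      rw [h0] at this
      have h2 : (lam i : ℝ) ≠ 0 := by exact_mod_cast hi
      have := this.symm
      rcases mul_eq_zero.mp this with h | h
      · exact absurd h h2
      · exact h
    have h1 : z v = ∑ i ∈ Finset.univ.filter (fun i => lam i = 0), u i v * c z i := by
      have := pars (Pi.single v 1) z
      simp only [Pi.single_apply, mul_ite, mul_one, mul_zero, ite_mul, one_mul, zero_mul,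
        Finset.sum_ite_eq', Finset.mem_univ, if_true] at this
      rw [← this, Finset.sum_filter]
      refine Finset.sum_congr rfl fun i _ => ?_
      by_cases hi : lam i = 0
      · simp [hi, hc]
      · have := hci i hi
        simp only [hc] at this
        simp [hi, this]
    rw [h1, p1]
    refine (Finset.sum_mul_sq_le_sq_mul_sq _ _ _).trans ?_
    refine mul_le_mul_of_nonneg_left ?_ (by positivity)
    exact Finset.sum_le_sum_of_subset_of_nonneg (Finset.filter_subset _ _)
      (fun _ _ _ => sq_nonneg _)
  · intro x hx
    have h1 := hN x
    have h2 : 0 < ∑ i ∈ Finset.univ.filter (fun i => lam i = 0), c x i ^ 2 := by linarith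
    obtain ⟨i, hi, hci⟩ := Finset.exists_ne_zero_of_sum_ne_zero h2.ne'
    refine ⟨u i, hnull i (by simpa using hi), ?_⟩
    intro h0
    apply hci
    simp only [hc]
    rw [h0]; simp
  · intro x j
    rw [p2, p3, p1, Finset.mul_sum, Finset.mul_sum, ← Finset.sum_sub_distrib,
      ← Finset.sum_add_distrib]
    refine Finset.sum_nonneg fun i _ => ?_
    have h1 : (0 : ℤ) ≤ (lam i - j) * (lam i - (j + 1)) := by
      rcases le_or_gt (lam i) j with h | h
      · exact mul_nonneg_of_nonpos_of_nonpos (by omega) (by omega)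
      · exact mul_nonneg (by omega) (by omega)
    have h2 : (0 : ℝ) ≤ ((lam i : ℝ) - j) * (lam i - (j + 1)) := by exact_mod_cast h1
    have := mul_nonneg h2 (sq_nonneg (c x i))
    nlinarith
  · intro j
    by_cases hj : ∃ i, j + 1 ≤ lam i
    · obtain ⟨i, hi⟩ := hj
      refine Or.inl ⟨lam i, hi, u i, ?_, eig i⟩
      intro h0
      have := orth i i
      rw [h0] at this
      simp at this
    · right
      push Not at hj
      intro x hx
      rw [p3, p1, Finset.mul_sum] at hx
      have h1 : ∑ i, ((j : ℝ) - lam i) * c x i ^ 2 = 0 := by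
        simp_rw [sub_mul]
        rw [Finset.sum_sub_distrib, hx, sub_self]
      have h2 : ∀ i, (0 : ℝ) ≤ (j : ℝ) - lam i := by
        intro i
        have := hj i
        have : lam i ≤ j := by omega
        have : (lam i : ℝ) ≤ j := by exact_mod_cast this
        linarith
      rw [Finset.sum_eq_zero_iff_of_nonneg (fun i _ => mul_nonneg (h2 i) (sq_nonneg _))] at h1
      have h3 : ∑ v, (Aop G x v - j * x v) ^ 2 = 0 := by
        have e : ∀ v, (Aop G x v - j * x v) ^ 2 = Aop G x v ^ 2 - 2 * j * (x v * Aop G x v)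
          + j ^ 2 * x v ^ 2 := fun v => by ring
        simp_rw [e]
        rw [Finset.sum_add_distrib, Finset.sum_sub_distrib, ← Finset.mul_sum, ← Finset.mul_sum,
          p2, p3, p1, Finset.mul_sum, Finset.mul_sum, ← Finset.sum_sub_distrib,
          ← Finset.sum_add_distrib]
        refine Finset.sum_eq_zero fun i hi => ?_
        have := h1 i hi
        linear_combination ((j : ℝ) - lam i) * this
      rw [Finset.sum_eq_zero_iff_of_nonneg (fun i _ => sq_nonneg _)] at h3
      intro v
      have := h3 v (Finset.mem_univ _)
      have := pow_eq_zero_iff (two_ne_zero) |>.mp this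
      linarith
  · intro hh s
    have h1 : 1 < (Finset.univ.filter (fun i => lam i = 0)).card := by omega
    obtain ⟨i, hi, j, hj, hij⟩ := Finset.one_lt_card.mp h1
    simp only [Finset.mem_filter, Finset.mem_univ, true_and] at hi hj
    by_cases hs : u i s = 0
    · refine ⟨u i, ?_, hnull i hi, hs⟩
      intro h0
      have := orth i i
      rw [h0] at this
      simp at this
    · refine ⟨fun v => u j s * u i v - u i s * u j v, ?_, ?_, by ring⟩
      · intro h0
        have h1 : ∑ v, (u j s * u i v - u i s * u j v) * u j v = 0 := by
          refine Finset.sum_eq_zero fun v _ => ?_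
          have := congrFun h0 v
          simp only [Pi.zero_apply] at this
          rw [this]; simp
        have h2 : ∑ v, (u j s * u i v - u i s * u j v) * u j v
            = u j s * ∑ v, u i v * u j v - u i s * ∑ v, u j v * u j v := by
          rw [Finset.mul_sum, Finset.mul_sum, ← Finset.sum_sub_distrib]
          refine Finset.sum_congr rfl fun v _ => by ring
        rw [h2, orth, orth] at h1
        simp [hij] at h1
        exact hs h1
      · intro v
        have e : Aop G (fun v => u j s * u i v - u i s * u j v) v
            = u j s * Aop G (u i) v - u i s * Aop G (u j) v := by
          unfold Aop
          rw [Finset.mul_sum, Finset.mul_sum, ← Finset.sum_sub_distrib]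
        rw [e, hnull i hi, hnull j hj]; ring

/-- A rooting of a tree: parent map and depth. -/
structure Rooted {V : Type*} (G : SimpleGraph V) (r : V) (p : V → V) (dep : V → ℕ) : Prop where
  par : ∀ v, v ≠ r → G.Adj v (p v)
  dpt : ∀ v, v ≠ r → dep (p v) + 1 = dep v
  adj : ∀ u v, G.Adj u v → (u ≠ r ∧ p u = v) ∨ (v ≠ r ∧ p v = u)

theorem exists_rooted {V : Type*} [Fintype V] {G : SimpleGraph V} (hG : G.IsTree) (r : V) :
    ∃ p dep, Rooted G r p dep := by
  have key : ∀ v, ∃ w, v ≠ r → G.Adj v w ∧ G.dist r w + 1 = G.dist r v := by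
    intro v
    by_cases hv : v = r
    · exact ⟨v, fun h => absurd hv h⟩
    · obtain ⟨P, hP⟩ := hG.connected.exists_walk_length_eq_dist v r
      cases P with
      | nil => exact absurd rfl hv
      | @cons _ w _ hvw Q =>
        refine ⟨w, fun _ => ⟨hvw, ?_⟩⟩
        have h1 : G.dist w r ≤ Q.length := SimpleGraph.dist_le Q
        rw [SimpleGraph.Walk.length_cons] at hP
        have h2 : G.dist v r ≤ G.dist w r + 1 := by
          obtain ⟨R, hR⟩ := hG.connected.exists_walk_length_eq_dist w r
          have := SimpleGraph.dist_le (SimpleGraph.Walk.cons hvw R)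
          rw [SimpleGraph.Walk.length_cons] at this
          omega
        rw [SimpleGraph.dist_comm (u := r), SimpleGraph.dist_comm (u := r)]
        omega
  choose p hp using key
  refine ⟨p, G.dist r, fun v hv => (hp v hv).1, fun v hv => (hp v hv).2, ?_⟩
  have hcard := hG.card_edgeFinset
  set f : V → Sym2 V := fun v => s(v, p v) with hf
  have hmaps : (Finset.univ.erase r).image f ⊆ G.edgeFinset := by
    intro e he
    simp only [Finset.mem_image, Finset.mem_erase, Finset.mem_univ, and_true] at he
    obtain ⟨v, hv, rfl⟩ := he
    simp only [hf, SimpleGraph.mem_edgeFinset, SimpleGraph.mem_edgeSet]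
    exact (hp v hv).1
  have hinj : Set.InjOn f (Finset.univ.erase r : Finset V) := by
    intro a ha b hb hab
    simp only [Finset.coe_erase, Finset.coe_univ, Set.mem_sdiff, Set.mem_univ, true_and,
      Set.mem_singleton_iff] at ha hb
    simp only [hf, Sym2.eq_iff] at hab
    rcases hab with h | ⟨h1, h2⟩
    · exact h.1
    · have e1 := (hp a ha).2
      have e2 := (hp b hb).2
      rw [h2] at e1
      rw [← h1] at e2
      omega
  have hc2 : ((Finset.univ.erase r).image f).card = Fintype.card V - 1 := by
    rw [Finset.card_image_of_injOn hinj, Finset.card_erase_of_mem (Finset.mem_univ _),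
      Finset.card_univ]
  have heq : (Finset.univ.erase r).image f = G.edgeFinset :=
    Finset.eq_of_subset_of_card_le hmaps (by omega)
  intro u v huv
  have : s(u, v) ∈ G.edgeFinset := by simpa using huv
  rw [← heq] at this
  simp only [Finset.mem_image, Finset.mem_erase, Finset.mem_univ, and_true, hf] at this
  obtain ⟨a, ha, hab⟩ := this
  rw [Sym2.eq_iff] at hab
  rcases hab with ⟨h1, h2⟩ | ⟨h1, h2⟩
  · subst h1; exact Or.inl ⟨ha, h2⟩
  · subst h1; exact Or.inr ⟨ha, h2⟩

/-- The adjacency action in terms of parents and children. -/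
theorem Rooted.aop {V : Type*} [Fintype V] {G : SimpleGraph V} {r : V} {p : V → V} {dep : V → ℕ}
    (R : Rooted G r p dep) (x : V → ℝ) (v : V) :
    Aop G x v = (if v ≠ r then x (p v) else 0)
      + ∑ u ∈ Finset.univ.filter (fun u => u ≠ r ∧ p u = v), x u := by
  unfold Aop
  by_cases hv : v = r
  · simp only [hv, ne_eq, not_true, if_false, zero_add]
    refine Finset.sum_congr ?_ fun _ _ => rfl
    ext u
    simp only [Finset.mem_filter, Finset.mem_univ, true_and]
    constructor
    · intro h
      rcases R.adj _ _ h with h | h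
      · exact absurd rfl h.1
      · exact h
    · rintro ⟨h1, h2⟩
      have := R.par u h1
      rw [h2] at this
      exact this.symm
  · simp only [ne_eq, hv, not_false_eq_true, if_true]
    have : Finset.univ.filter (fun u => G.Adj v u)
        = insert (p v) (Finset.univ.filter (fun u => u ≠ r ∧ p u = v)) := by
      ext u
      simp only [Finset.mem_filter, Finset.mem_univ, true_and, Finset.mem_insert]
      constructor
      · intro h
        rcases R.adj _ _ h with h | h
        · exact Or.inl h.2.symm
        · exact Or.inr h
      · rintro (h | ⟨h1, h2⟩)
        · subst h; exact R.par v hv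
        · have := R.par u h1
          rw [h2] at this
          exact this.symm
    rw [this, Finset.sum_insert]
    intro h
    simp only [Finset.mem_filter, Finset.mem_univ, true_and] at h
    have e1 := R.dpt v hv
    have e2 := R.dpt _ h.1
    rw [h.2] at e2
    omega

/-- Two adjacent vertices cannot both be in the supports of null vectors. -/
theorem null_adj {V : Type*} [Fintype V] {G : SimpleGraph V} (hG : G.IsTree) {s t : V}
    (hst : G.Adj s t) {x y : V → ℝ} (hx : ∀ v, Aop G x v = 0) (hy : ∀ v, Aop G y v = 0)
    (hxs : x s ≠ 0) (hyt : y t ≠ 0) : False := by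
  obtain ⟨p, dep, R⟩ := exists_rooted hG t
  have hs : s ≠ t := hst.ne
  have hps : p s = t := by
    rcases R.adj _ _ hst with h | h
    · exact h.2
    · exact absurd rfl h.1
  obtain ⟨D, hD, hDs, hDt⟩ : ∃ D : V → Prop, (∀ a b, G.Adj a b → D a → ¬ D b → a = s ∧ b = t)
      ∧ D s ∧ ¬ D t := by
    refine ⟨fun v => ∃ k, p^[k] v = s ∧ ∀ i ≤ k, p^[i] v ≠ t, ?_, ⟨0, rfl, ?_⟩, ?_⟩
    · rintro a b hab ⟨k, hk, hk2⟩ hb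
      rcases R.adj _ _ hab with ⟨h1, h2⟩ | ⟨h1, h2⟩
      · cases k with
        | zero =>
          have : a = s := hk
          subst this
          exact ⟨rfl, by rw [← h2, hps]⟩
        | succ k =>
          exfalso
          apply hb
          refine ⟨k, ?_, ?_⟩
          · rw [← h2]; rw [Function.iterate_succ_apply] at hk; exact hk
          · intro i hi
            have := hk2 (i + 1) (by omega)
            rw [Function.iterate_succ_apply, h2] at this
            exact this
      · exfalso
        apply hb
        refine ⟨k + 1, ?_, ?_⟩
        · rw [Function.iterate_succ_apply, h2]; exact hk
        · intro i hi
          cases i with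
          | zero => exact h1
          | succ i =>
            rw [Function.iterate_succ_apply, h2]
            exact hk2 i (by omega)
    · intro i hi
      have : i = 0 := by omega
      subst this
      exact hs
    · rintro ⟨k, hk, hk2⟩
      exact hk2 0 (by omega) rfl
  have ident : ∀ x y : V → ℝ, (∀ v, Aop G x v = 0) → (∀ v, Aop G y v = 0) →
      x s * y t = x t * y s := by
    intro x y hx hy
    have h1 : ∑ v ∈ Finset.univ.filter D, (x v * Aop G y v - y v * Aop G x v) = 0 :=
      Finset.sum_eq_zero fun v _ => by rw [hx, hy]; ring
    have h2 : ∀ x y : V → ℝ, ∑ v ∈ Finset.univ.filter D, x v * Aop G y v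
        = ∑ v ∈ Finset.univ.filter D, ∑ u ∈ Finset.univ.filter D,
          (if G.Adj v u then x v * y u else 0) + x s * y t := by
      intro x y
      have e1 : ∀ v, x v * Aop G y v = ∑ u, (if G.Adj v u then x v * y u else 0) := by
        intro v
        unfold Aop
        rw [Finset.mul_sum, Finset.sum_filter]
      have e2 : ∀ v, ∑ u, (if G.Adj v u then x v * y u else 0)
          = ∑ u ∈ Finset.univ.filter D, (if G.Adj v u then x v * y u else 0)
          + ∑ u ∈ Finset.univ.filter (fun u => ¬ D u), (if G.Adj v u then x v * y u else 0) :=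
        fun v => (Finset.sum_filter_add_sum_filter_not _ _ _).symm
      simp_rw [e1, e2]
      rw [Finset.sum_add_distrib]
      congr 1
      rw [Finset.sum_eq_single_of_mem s (by simpa using hDs)]
      · rw [Finset.sum_eq_single_of_mem t (by simpa using hDt)]
        · simp [hst]
        · intro u hu hut
          simp only [Finset.mem_filter, Finset.mem_univ, true_and] at hu
          rw [if_neg]
          intro h
          exact hut (hD _ _ h hDs hu).2
      · intro v hv hvs
        simp only [Finset.mem_filter, Finset.mem_univ, true_and] at hv
        refine Finset.sum_eq_zero fun u hu => ?_
        simp only [Finset.mem_filter, Finset.mem_univ, true_and] at hu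
        rw [if_neg]
        intro h
        exact hvs (hD _ _ h hv hu).1
    rw [Finset.sum_sub_distrib, h2, h2] at h1
    have h3 : ∑ v ∈ Finset.univ.filter D, ∑ u ∈ Finset.univ.filter D,
          (if G.Adj v u then x v * y u else 0)
        = ∑ v ∈ Finset.univ.filter D, ∑ u ∈ Finset.univ.filter D,
          (if G.Adj v u then y v * x u else 0) := by
      rw [Finset.sum_comm]
      refine Finset.sum_congr rfl fun v _ => Finset.sum_congr rfl fun u _ => ?_
      rw [G.adj_comm, mul_comm]
    rw [h3] at h1
    linarith
  have hsgn : ∃ x' : V → ℝ, (∀ v, Aop G x' v = 0) ∧ x' s = x s ∧ x' t = - x t := by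
    refine ⟨fun v => ((-1) ^ (dep v) * (-1) ^ (dep s)) * x v, ?_, ?_, ?_⟩
    · intro v
      have : Aop G (fun v => ((-1) ^ (dep v) * (-1) ^ (dep s)) * x v) v
          = - ((-1) ^ (dep v) * (-1) ^ (dep s)) * Aop G x v := by
        unfold Aop
        rw [Finset.mul_sum]
        refine Finset.sum_congr rfl fun u hu => ?_
        simp only [Finset.mem_filter, Finset.mem_univ, true_and] at hu
        show (-1) ^ dep u * (-1) ^ dep s * x u = _
        rcases R.adj _ _ hu with ⟨h1, h2⟩ | ⟨h1, h2⟩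
        · have := R.dpt _ h1
          rw [h2] at this
          rw [← this]
          simp [pow_succ]
        · have := R.dpt _ h1
          rw [h2] at this
          rw [← this]
          simp [pow_succ]
      rw [this, hx, mul_zero]
    · show (-1) ^ (dep s) * (-1) ^ (dep s) * x s = x s
      rw [← mul_pow]; simp
    · have := R.dpt s hs
      rw [hps] at this
      show (-1) ^ (dep t) * (-1) ^ (dep s) * x t = - x t
      rw [← this, pow_succ, ← mul_assoc, ← mul_pow]
      simp
  obtain ⟨x', hx', e1, e2⟩ := hsgn
  have i1 := ident x y hx hy
  have i2 := ident x' y hx' hy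
  rw [e1, e2] at i2
  have : x s * y t = 0 := by linarith
  rcases mul_eq_zero.mp this with h | h
  · exact hxs h
  · exact hyt h

section Structural

variable {V : Type*} [Fintype V] {G : SimpleGraph V}

/-- A leaf: exactly one neighbour. -/
def Leaf (G : SimpleGraph V) (v : V) : Prop := ∃ a, ∀ u, G.Adj v u ↔ u = a

/-- A middle vertex of a pendant path of length two. -/
def Mid (G : SimpleGraph V) (v : V) : Prop :=
  ∃ b c, b ≠ c ∧ Leaf G b ∧ ∀ u, G.Adj v u ↔ u = b ∨ u = c

/-- Core vertices: neither leaves nor middle vertices. -/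
def Core (G : SimpleGraph V) (v : V) : Prop := ¬ Leaf G v ∧ ¬ Mid G v

theorem card_le_of_closed (hG : G.Connected) (S : Finset V) (a : V) (ha : a ∈ S)
    (hS : ∀ u ∈ S, ∀ v, G.Adj u v → v ∈ S) : Fintype.card V ≤ S.card := by
  have : ∀ v, v ∈ S := by
    intro v
    obtain ⟨P⟩ := hG.preconnected a v
    induction P with
    | nil => exact ha
    | cons h _ ih => exact ih (hS _ ha _ h)
  rw [← Finset.card_univ]
  exact Finset.card_le_card fun v _ => this v

theorem Leaf.unique {v a b : V} (h : Leaf G v) (ha : G.Adj v a) (hb : G.Adj v b) : a = b := by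
  obtain ⟨c, hc⟩ := h
  rw [(hc a).1 ha, (hc b).1 hb]

theorem Leaf.adj_iff {v a u : V} (h : Leaf G v) (ha : G.Adj v a) : G.Adj v u ↔ u = a := by
  constructor
  · intro hu; exact h.unique hu ha
  · rintro rfl; exact ha

theorem not_leaf_of_mid {v : V} (h : Mid G v) : ¬ Leaf G v := by
  obtain ⟨b, c, hbc, -, hu⟩ := h
  intro hl
  exact hbc (hl.unique ((hu b).2 (Or.inl rfl)) ((hu c).2 (Or.inr rfl)))

theorem not_leaf_leaf (hG : G.Connected) (hn : 5 ≤ Fintype.card V) {u v : V} (hu : Leaf G u) (huv : G.Adj u v) : ¬ Leaf G v := by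
  intro hv
  have := card_le_of_closed hG {u, v} u (by simp) (by
    intro x hx y hxy
    simp only [Finset.mem_insert, Finset.mem_singleton] at hx ⊢
    rcases hx with rfl | rfl
    · exact Or.inr (hu.unique hxy huv)
    · exact Or.inl (hv.unique hxy huv.symm))
  have h2 := Finset.card_le_two (a := u) (b := v)
  omega

/-- The structure of a middle vertex. -/
theorem Mid.exists (hG : G.Connected) (hn : 5 ≤ Fintype.card V) {a : V} (ha : Mid G a) :
    ∃ b c, b ≠ c ∧ Leaf G b ∧ Core G c ∧ ∀ u, G.Adj a u ↔ u = b ∨ u = c := by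
  obtain ⟨b, c, hbc, hb, hu⟩ := ha
  have hab : G.Adj a b := (hu b).2 (Or.inl rfl)
  have hac : G.Adj a c := (hu c).2 (Or.inr rfl)
  refine ⟨b, c, hbc, hb, ⟨?_, ?_⟩, hu⟩
  · intro hc
    have := card_le_of_closed hG {a, b, c} a (by simp) (by
      intro x hx y hxy
      simp only [Finset.mem_insert, Finset.mem_singleton] at hx ⊢
      rcases hx with rfl | rfl | rfl
      · exact Or.inr ((hu y).1 hxy)
      · exact Or.inl (hb.unique hxy hab.symm)
      · exact Or.inl (hc.unique hxy hac.symm))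
    have h2 := Finset.card_le_three (a := a) (b := b) (c := c)
    omega
  · rintro ⟨b', c', hbc', hb', hu'⟩
    rcases (hu' a).1 hac.symm with h | h
    · subst h
      exact not_leaf_of_mid ⟨b, c, hbc, hb, hu⟩ hb'
    · subst h
      have hcb' : G.Adj c b' := (hu' b').2 (Or.inl rfl)
      have := card_le_of_closed hG {a, b, c, b'} a (by simp) (by
        intro x hx y hxy
        simp only [Finset.mem_insert, Finset.mem_singleton] at hx ⊢
        rcases hx with rfl | rfl | rfl | rfl
        · rcases (hu y).1 hxy with h | h <;> simp [h]
        · exact Or.inl (hb.unique hxy hab.symm)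
        · rcases (hu' y).1 hxy with h | h <;> simp [h]
        · exact Or.inr (Or.inr (Or.inl (hb'.unique hxy hcb'.symm))))
      have h2 := Finset.card_le_four (a := a) (b := b) (c := c) (d := b')
      omega

theorem Mid.leaf (hG : G.Connected) (hn : 5 ≤ Fintype.card V) {a v : V} (ha : Mid G a) (hv : Core G v) (hav : G.Adj a v) :
    ∃ b, b ≠ v ∧ Leaf G b ∧ ∀ u, G.Adj a u ↔ u = b ∨ u = v := by
  obtain ⟨b, c, hbc, hb, hc, hu⟩ := ha.exists hG hn
  rcases (hu v).1 hav with h | h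
  · subst h; exact absurd hb hv.1
  · subst h; exact ⟨b, hbc, hb, hu⟩

theorem Mid.core_unique (hG : G.Connected) (hn : 5 ≤ Fintype.card V) {a v v' : V} (ha : Mid G a) (hv : Core G v) (hav : G.Adj a v)
    (hv' : Core G v') (hav' : G.Adj a v') : v = v' := by
  obtain ⟨b, hbc, hb, hu⟩ := ha.leaf hG hn hv hav
  rcases (hu v').1 hav' with h | h
  · subst h; exact absurd hb hv'.1
  · exact h.symm

/-- The owner map. -/
structure Own (G : SimpleGraph V) (own : V → V) : Prop where
  core : ∀ v, Core G (own v)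
  self : ∀ v, Core G v → own v = v
  adj : ∀ u v, Core G v → ¬ Core G u → G.Adj u v → own u = v
  far : ∀ b a v, Leaf G b → Mid G a → Core G v → G.Adj b a → G.Adj a v → own b = v
  ex : ∀ u, own u = u ∨ G.Adj u (own u) ∨ ∃ a, G.Adj u a ∧ G.Adj a (own u)

theorem exists_own (hG : G.Connected) (hn : 5 ≤ Fintype.card V) : ∃ own : V → V, Own G own := by
  have key : ∀ u, ∃ o, Core G o ∧ (Core G u → o = u) ∧
      (∀ v, Core G v → ¬ Core G u → G.Adj u v → o = v) ∧
      (∀ a v, Leaf G u → Mid G a → Core G v → G.Adj u a → G.Adj a v → o = v) ∧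
      (o = u ∨ G.Adj u o ∨ ∃ a, G.Adj u a ∧ G.Adj a o) := by
    intro u
    by_cases hu : Core G u
    · exact ⟨u, hu, fun _ => rfl, fun v _ h => absurd hu h,
        fun a v h => absurd h hu.1, Or.inl rfl⟩
    by_cases hm : Mid G u
    · obtain ⟨b, c, hbc, hb, hc, h⟩ := hm.exists hG hn
      have huc := (h c).2 (Or.inr rfl)
      exact ⟨c, hc, fun h => absurd h hu, fun v hv _ huv => hm.core_unique hG hn hc huc hv huv,
        fun a v h => absurd h (not_leaf_of_mid hm), Or.inr (Or.inl huc)⟩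
    have hl : Leaf G u := by
      by_contra hl
      exact hu ⟨hl, hm⟩
    obtain ⟨a, ha⟩ := id hl
    have hua : G.Adj u a := (ha a).2 rfl
    by_cases hma : Mid G a
    · obtain ⟨b, c, hbc, hb, hc, h⟩ := hma.exists hG hn
      have hac := (h c).2 (Or.inr rfl)
      refine ⟨c, hc, fun h => absurd h hu, ?_, ?_, Or.inr (Or.inr ⟨a, hua, hac⟩)⟩
      · intro v hv _ huv
        have := (ha v).1 huv
        subst this
        exact absurd hma hv.2
      · intro a' v _ _ hv hua' hav
        have := (ha a').1 hua'
        subst this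
        exact hma.core_unique hG hn hc hac hv hav
    · have hca : Core G a := ⟨not_leaf_leaf hG hn hl hua, hma⟩
      refine ⟨a, hca, fun h => absurd h hu, ?_, ?_, Or.inr (Or.inl hua)⟩
      · intro v hv _ huv
        exact ((ha v).1 huv).symm
      · intro a' v _ hm' hv hua' hav
        have := (ha a').1 hua'
        subst this
        exact absurd hm' hma
  choose own h1 h2 h3 h4 h5 using key
  exact ⟨own, h1, h2, fun u v hv hu h => h3 u v hv hu h,
    fun b a v hb ha hv h h' => h4 b a v hb ha hv h h', h5⟩

/-- The test vector at a core vertex. -/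
noncomputable def yv (G : SimpleGraph V) (v : V) (u : V) : ℝ :=
  if u = v then 1 else if ∃ a, Mid G a ∧ G.Adj v a ∧ G.Adj a u then -1 else 0

theorem aop_yv (hG : G.Connected) (hn : 5 ≤ Fintype.card V) {v : V} (hv : Core G v) (u : V) :
    Aop G (yv G v) u = if G.Adj v u ∧ ¬ Mid G u then 1 else 0 := by
  unfold Aop
  by_cases huv : G.Adj v u
  · by_cases hm : Mid G u
    · obtain ⟨b, hbv, hb, hu⟩ := hm.leaf hG hn hv huv.symm
      have : Finset.univ.filter (fun t => G.Adj u t) = {b, v} := by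
        ext t; simp [hu]
      rw [this, Finset.sum_pair hbv]
      have hb1 : yv G v b = -1 := by
        unfold yv
        rw [if_neg hbv, if_pos ⟨u, hm, huv, (hu b).2 (Or.inl rfl)⟩]
      have hv1 : yv G v v = 1 := by simp [yv]
      rw [hb1, hv1]; simp [hm]
    · rw [if_pos ⟨huv, hm⟩, Finset.sum_eq_single_of_mem v (by simpa using huv.symm)]
      · simp [yv]
      · intro t ht htv
        simp only [Finset.mem_filter, Finset.mem_univ, true_and] at ht
        unfold yv
        rw [if_neg htv, if_neg]
        rintro ⟨a, ha, hva, hat⟩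
        obtain ⟨b, hbv, hb, hu⟩ := ha.leaf hG hn hv hva.symm
        rcases (hu t).1 hat with h | h
        · subst h
          have := hb.unique ht.symm hat.symm
          subst this
          exact hm ha
        · exact htv h
  · rw [if_neg (fun h => huv h.1)]
    refine Finset.sum_eq_zero fun t ht => ?_
    simp only [Finset.mem_filter, Finset.mem_univ, true_and] at ht
    have htv : t ≠ v := by
      rintro rfl
      exact huv ht.symm
    unfold yv
    rw [if_neg htv, if_neg]
    rintro ⟨a, ha, hva, hat⟩
    obtain ⟨b, hbv, hb, hu⟩ := ha.leaf hG hn hv hva.symm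
    rcases (hu t).1 hat with h | h
    · subst h
      have := hb.unique ht.symm hat.symm
      subst this
      exact huv hva
    · exact htv h

theorem yv_supp (hG : G.Connected) (hn : 5 ≤ Fintype.card V) {own : V → V} (hO : Own G own) {v : V} (hv : Core G v) {u : V}
    (hu : yv G v u ≠ 0) : own u = v := by
  unfold yv at hu
  by_cases huv : u = v
  · subst huv; exact hO.self _ hv
  · rw [if_neg huv] at hu
    by_cases h : ∃ a, Mid G a ∧ G.Adj v a ∧ G.Adj a u
    · obtain ⟨a, ha, hva, hau⟩ := h
      obtain ⟨b, hbv, hb, hh⟩ := ha.leaf hG hn hv hva.symm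
      rcases (hh u).1 hau with h | h
      · subst h
        exact hO.far _ a v hb ha hv hau.symm hva.symm
      · exact absurd h huv
    · rw [if_neg h] at hu
      exact absurd rfl hu

theorem yv_self (v : V) : yv G v v = 1 := by simp [yv]

/-- The squared norm of the test vector is at least one plus the number of middle neighbours. -/
theorem yv_norm (hG : G.Connected) (hn : 5 ≤ Fintype.card V) {v : V} (hv : Core G v) :
    1 + ((Finset.univ.filter (fun a => G.Adj v a ∧ Mid G a)).card : ℝ) ≤ ∑ u, yv G v u ^ 2 := by
  set K := Finset.univ.filter (fun a => G.Adj v a ∧ Mid G a) with hK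
  have hb : ∀ a : V, ∃ b, a ∈ K → b ≠ v ∧ Leaf G b ∧ ∀ u, G.Adj a u ↔ u = b ∨ u = v := by
    intro a
    by_cases ha : a ∈ K
    · simp only [hK, Finset.mem_filter, Finset.mem_univ, true_and] at ha
      obtain ⟨b, h⟩ := ha.2.leaf hG hn hv ha.1.symm
      exact ⟨b, fun _ => h⟩
    · exact ⟨a, fun h => absurd h ha⟩
  choose f hf using hb
  have hinj : Set.InjOn f K := by
    intro a ha a' ha' h
    have e1 := hf a ha
    have e2 := hf a' ha'
    have i1 := ((e1.2.2 (f a)).2 (Or.inl rfl)).symm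
    have i2 := ((e2.2.2 (f a')).2 (Or.inl rfl)).symm
    rw [← h] at i2
    exact e1.2.1.unique i1 i2
  have hnot : v ∉ K.image f := by
    intro h
    obtain ⟨a, ha, h⟩ := Finset.mem_image.1 h
    exact (hf a ha).1 h
  have h1 : ∑ u ∈ insert v (K.image f), yv G v u ^ 2 = 1 + (K.card : ℝ) := by
    rw [Finset.sum_insert hnot, yv_self, Finset.sum_image hinj]
    have : ∀ a ∈ K, yv G v (f a) ^ 2 = 1 := by
      intro a ha
      have e1 := hf a ha
      unfold yv
      rw [if_neg e1.1, if_pos]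
      · norm_num
      · refine ⟨a, ?_, ?_, (e1.2.2 _).2 (Or.inl rfl)⟩
        · simp only [hK, Finset.mem_filter] at ha; exact ha.2.2
        · simp only [hK, Finset.mem_filter] at ha; exact ha.2.1
    rw [Finset.sum_congr rfl this]
    simp
  rw [← h1]
  exact Finset.sum_le_sum_of_subset_of_nonneg (Finset.subset_univ _) fun _ _ _ => sq_nonneg _

end Structural


section Mass

variable {V : Type*} [Fintype V] {G : SimpleGraph V} {h : ℕ} {own : V → V} {w : V → ℝ}

/-- The data used in bounding the core. -/
structure Ctx (G : SimpleGraph V) (h : ℕ) (own : V → V) (w : V → ℝ) : Prop where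
  tree : G.IsTree
  card : 5 ≤ Fintype.card V
  own : Own G own
  wpos : ∀ v, 0 ≤ w v
  wsum : ∑ v, w v = h
  wmass : ∀ x : V → ℝ, ∑ v, x v ^ 2 - ∑ v, Aop G x v ^ 2 ≤
      (∑ v, x v ^ 2) * ∑ v ∈ Finset.univ.filter (fun v => x v ≠ 0), w v
  wnull : ∀ z : V → ℝ, (∀ v, Aop G z v = 0) → ∀ v, z v ^ 2 ≤ w v * ∑ v, z v ^ 2

/-- Mass owned by a vertex. -/
noncomputable def mm (own : V → V) (w : V → ℝ) (v : V) : ℝ :=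
  ∑ u ∈ Finset.univ.filter (fun u => own u = v), w u

theorem Ctx.conn (C : Ctx G h own w) : G.Connected := C.tree.connected

theorem Ctx.mm_nonneg (C : Ctx G h own w) (v : V) : 0 ≤ mm own w v :=
  Finset.sum_nonneg fun u _ => C.wpos u

theorem Ctx.mm_sum (C : Ctx G h own w) (S : Finset V) : ∑ v ∈ S, mm own w v ≤ h := by
  calc ∑ v ∈ S, mm own w v ≤ ∑ v, mm own w v :=
        Finset.sum_le_sum_of_subset_of_nonneg (Finset.subset_univ _) fun v _ _ => C.mm_nonneg v
    _ = ∑ v, w v := by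
        unfold mm
        exact Finset.sum_fiberwise _ _ _
    _ = h := C.wsum

theorem Ctx.mass (C : Ctx G h own w) (S : Finset V) (x : V → ℝ) (α β : ℝ) (hb : 0 ≤ β)
    (hS : ∀ u, x u ≠ 0 → own u ∈ S) (hα : ∑ v, Aop G x v ^ 2 ≤ α) (hβ : β ≤ ∑ v, x v ^ 2) :
    β - α ≤ β * ∑ v ∈ S, mm own w v := by
  have h1 : ∑ v ∈ Finset.univ.filter (fun v => x v ≠ 0), w v ≤ ∑ v ∈ S, mm own w v := by
    unfold mm
    have e : ∑ v ∈ S, ∑ u ∈ Finset.univ.filter (fun u => own u = v), w u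
        = ∑ u ∈ Finset.univ.filter (fun u => own u ∈ S), w u := by
      convert Finset.sum_fiberwise_eq_sum_filter Finset.univ S own w
    rw [e]
    refine Finset.sum_le_sum_of_subset_of_nonneg ?_ fun v _ _ => C.wpos v
    intro u hu
    simp only [Finset.mem_filter, Finset.mem_univ, true_and] at hu ⊢
    exact hS u hu
  have h2 := C.wmass x
  have h3 : 0 ≤ ∑ v, Aop G x v ^ 2 := Finset.sum_nonneg fun _ _ => sq_nonneg _
  have h4 : 0 ≤ ∑ v, x v ^ 2 := Finset.sum_nonneg fun _ _ => sq_nonneg _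
  have h5 : 0 ≤ ∑ v ∈ S, mm own w v := Finset.sum_nonneg fun v _ => C.mm_nonneg v
  set M := ∑ v ∈ S, mm own w v
  set N := ∑ v, x v ^ 2
  have h6 : N - α ≤ N * M := by
    have := mul_le_mul_of_nonneg_left h1 h4
    linarith
  rcases le_or_gt 1 M with hM | hM
  · nlinarith
  · nlinarith

theorem Ctx.card_half (C : Ctx G h own w) :
    (Finset.univ.filter (fun v => 1 / 2 ≤ mm own w v)).card ≤ 2 * h := by
  have h1 := C.mm_sum (Finset.univ.filter (fun v => 1 / 2 ≤ mm own w v))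
  have h2 := Finset.card_nsmul_le_sum (Finset.univ.filter (fun v => 1 / 2 ≤ mm own w v))
    (mm own w) (1 / 2) (fun v hv => by simpa using hv)
  rw [nsmul_eq_mul] at h2
  have : ((Finset.univ.filter (fun v => 1 / 2 ≤ mm own w v)).card : ℝ) ≤ 2 * h := by linarith
  exact_mod_cast this

theorem aop_add (x y : V → ℝ) (v : V) :
    Aop G (fun u => x u + y u) v = Aop G x v + Aop G y v := Finset.sum_add_distrib

theorem aop_sub (x y : V → ℝ) (v : V) :
    Aop G (fun u => x u - y u) v = Aop G x v - Aop G y v := Finset.sum_sub_distrib _ _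

/-- Indicator of a vertex. -/
noncomputable def ee (a : V) (u : V) : ℝ := if u = a then 1 else 0

theorem aop_ee (a v : V) : Aop G (ee a) v = if G.Adj a v then 1 else 0 := by
  unfold Aop ee
  rw [Finset.sum_ite_eq']
  simp [G.adj_comm]

theorem aop_ee_leaf {a v : V} (ha : Leaf G a) (hav : G.Adj a v) (u : V) :
    Aop G (ee a) u = ee v u := by
  rw [aop_ee]
  unfold ee
  simp [ha.adj_iff hav]

theorem sum_ee_sq (a : V) : ∑ u, ee a u ^ 2 = 1 := by
  unfold ee
  simp

/-- Dirty: two leaves. -/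
theorem Ctx.two_leaves (C : Ctx G h own w) {v a b : V} (ha : Leaf G a)
    (hb : Leaf G b) (hab : a ≠ b) (hva : G.Adj a v) (hvb : G.Adj b v) : 1 / 2 ≤ w a := by
  have h0 : ∀ u, Aop G (fun u => ee a u - ee b u) u = 0 := by
    intro u
    rw [aop_sub, aop_ee_leaf ha hva, aop_ee_leaf hb hvb, sub_self]
  have := C.wnull _ h0 a
  have e : ∑ u, (ee a u - ee b u) ^ 2 = 2 := by
    have : ∀ u, (ee a u - ee b u) ^ 2 = ee a u ^ 2 + ee b u ^ 2 := by
      intro u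
      unfold ee
      by_cases h1 : u = a
      · subst h1; simp [hab]
      · simp [h1]
    simp_rw [this]
    rw [Finset.sum_add_distrib, sum_ee_sq, sum_ee_sq]
    norm_num
  rw [e] at this
  simp [ee, hab] at this
  linarith

theorem Ctx.le_mm (C : Ctx G h own w) {a v : V} (hav : own a = v) : w a ≤ mm own w v := by
  unfold mm
  exact Finset.single_le_sum (f := w) (fun u _ => C.wpos u) (by simpa using hav)

theorem Ctx.dirty_two (C : Ctx G h own w) {v a b : V} (hv : Core G v) (ha : Leaf G a)
    (hb : Leaf G b) (hab : a ≠ b) (hva : G.Adj a v) (hvb : G.Adj b v) : 1 / 2 ≤ mm own w v :=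
  (C.two_leaves ha hb hab hva hvb).trans
    (C.le_mm (C.own.adj a v hv (fun h => h.1 ha) hva))

/-- The number of leaves at a vertex is bounded. -/
theorem Ctx.leaf_card (C : Ctx G h own w) (v : V) :
    (Finset.univ.filter (fun a => G.Adj v a ∧ Leaf G a)).card ≤ 2 * h + 1 := by
  set L := Finset.univ.filter (fun a => G.Adj v a ∧ Leaf G a) with hL
  rcases le_or_gt L.card 1 with h1 | h1
  · omega
  · have hw : ∀ a ∈ L, 1 / 2 ≤ w a := by
      intro a ha
      obtain ⟨b, hb, hba⟩ := Finset.exists_mem_ne h1 a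
      simp only [hL, Finset.mem_filter, Finset.mem_univ, true_and] at ha hb
      exact C.two_leaves ha.2 hb.2 hba.symm ha.1.symm hb.1.symm
    have h2 := Finset.card_nsmul_le_sum L w (1 / 2) hw
    have h3 : ∑ v ∈ L, w v ≤ h := by
      rw [← C.wsum]
      exact Finset.sum_le_sum_of_subset_of_nonneg (Finset.subset_univ _) fun v _ _ => C.wpos v
    rw [nsmul_eq_mul] at h2
    have : (L.card : ℝ) ≤ 2 * h := by linarith
    have : L.card ≤ 2 * h := by exact_mod_cast this
    omega

theorem Ctx.dirty_mid (C : Ctx G h own w) {v a b : V} (hv : Core G v) (ha : Leaf G a)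
    (hb : Mid G b) (hva : G.Adj a v) (hvb : G.Adj b v) : 1 / 2 ≤ mm own w v := by
  have hab : a ≠ b := by
    rintro rfl
    exact not_leaf_of_mid hb ha
  obtain ⟨c, hcv, hc, hu⟩ := hb.leaf C.conn C.card hv hvb
  have h1 := C.mass {v} (fun u => ee a u - ee b u) 1 2 (by norm_num) ?_ ?_ ?_
  · rw [Finset.sum_singleton] at h1
    linarith
  · intro u hu
    rw [Finset.mem_singleton]
    unfold ee at hu
    by_cases h1 : u = a
    · subst h1
      exact C.own.adj u v hv (fun h => h.1 ha) hva
    · by_cases h2 : u = b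
      · subst h2
        exact C.own.adj u v hv (fun h => h.2 hb) hvb
      · simp [h1, h2] at hu
  · have : ∀ u, Aop G (fun u => ee a u - ee b u) u ^ 2 = ee c u ^ 2 := by
      intro u
      rw [aop_sub, aop_ee_leaf ha hva, aop_ee]
      unfold ee
      by_cases h1 : u = c
      · subst h1; simp [hu, hcv]
      · by_cases h2 : u = v
        · subst h2; simp [hu, h1]
        · simp [hu, h1, h2]
    simp_rw [this, sum_ee_sq]; rfl
  · have : ∀ u, (ee a u - ee b u) ^ 2 = ee a u ^ 2 + ee b u ^ 2 := by
      intro u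
      unfold ee
      by_cases h1 : u = a
      · subst h1; simp [hab]
      · simp [h1]
    simp_rw [this]
    rw [Finset.sum_add_distrib, sum_ee_sq, sum_ee_sq]
    norm_num

/-- Core neighbours. -/
noncomputable def cn (G : SimpleGraph V) (v : V) : Finset V :=
  Finset.univ.filter (fun u => G.Adj v u ∧ Core G u)

theorem Ctx.exists_adj (C : Ctx G h own w) (v : V) : ∃ u, G.Adj v u := by
  by_contra hcon
  push Not at hcon
  have := card_le_of_closed C.conn {v} v (by simp) (by
    intro x hx y hxy
    rw [Finset.mem_singleton] at hx
    subst hx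
    exact absurd hxy (hcon y))
  have := C.card
  simp at *
  omega

/-- Core vertices with at most one core neighbour carry mass. -/
theorem Ctx.low (C : Ctx G h own w) {v : V} (hv : Core G v) (hq : (cn G v).card ≤ 1) :
    1 / 2 ≤ mm own w v := by
  by_contra hlt
  have hq' := Finset.card_le_one.1 hq
  have hq'' : ∀ a b, G.Adj v a → Core G a → G.Adj v b → Core G b → a = b := by
    intro a b h1 h2 h3 h4
    exact hq' a (by simp [cn, h1, h2]) b (by simp [cn, h3, h4])
  by_cases hl : ∃ a, Leaf G a ∧ G.Adj a v
  · obtain ⟨a, ha, hav⟩ := hl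
    have hcore : ∀ u, G.Adj v u → u ≠ a → Core G u := by
      intro u hu hua
      refine ⟨fun h => hlt (C.dirty_two hv ha h hua.symm hav hu.symm),
        fun h => hlt (C.dirty_mid hv ha h hav hu.symm)⟩
    by_cases hc : ∃ c, G.Adj v c ∧ c ≠ a
    · obtain ⟨c, hvc, hca⟩ := hc
      apply hv.2
      refine ⟨a, c, hca.symm, ha, fun u => ⟨?_, ?_⟩⟩
      · intro hu
        by_cases hua : u = a
        · exact Or.inl hua
        · exact Or.inr (hq'' _ _ hu (hcore u hu hua) hvc (hcore c hvc hca))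
      · rintro (rfl | rfl)
        · exact hav.symm
        · exact hvc
    · push Not at hc
      apply hv.1
      refine ⟨a, fun u => ⟨hc u, ?_⟩⟩
      rintro rfl
      exact hav.symm
  · push Not at hl
    by_cases hk : ∃ a, Mid G a ∧ G.Adj v a
    · obtain ⟨a, ha, hva⟩ := hk
      have h1 := C.mass {v} (yv G v) 1 2 (by norm_num) ?_ ?_ ?_
      · rw [Finset.sum_singleton] at h1
        exact hlt (by linarith)
      · intro u hu
        rw [Finset.mem_singleton]
        exact yv_supp C.conn C.card C.own hv hu
      · have : ∀ u, Aop G (yv G v) u ^ 2 = if u ∈ cn G v then 1 else 0 := by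
          intro u
          rw [aop_yv C.conn C.card hv]
          by_cases hu : G.Adj v u ∧ ¬ Mid G u
          · have : u ∈ cn G v := by
              simp only [cn, Finset.mem_filter, Finset.mem_univ, true_and]
              exact ⟨hu.1, fun h => hl u h hu.1.symm, hu.2⟩
            simp [hu, this]
          · have : u ∉ cn G v := by
              simp only [cn, Finset.mem_filter, Finset.mem_univ, true_and]
              exact fun h => hu ⟨h.1, h.2.2⟩
            rw [if_neg hu, if_neg this]; norm_num
        simp_rw [this]
        rw [Finset.sum_ite_mem, Finset.univ_inter, Finset.sum_const, nsmul_eq_mul, mul_one]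
        exact_mod_cast hq
      · have := yv_norm C.conn C.card hv
        have h2 : 1 ≤ (Finset.univ.filter (fun a => G.Adj v a ∧ Mid G a)).card :=
          Finset.card_pos.2 ⟨a, by simp [hva, ha]⟩
        have h3 : (1 : ℝ) ≤ (Finset.univ.filter (fun a => G.Adj v a ∧ Mid G a)).card := by
          exact_mod_cast h2
        linarith
    · push Not at hk
      obtain ⟨u, hu⟩ := C.exists_adj v
      have hcore : ∀ u, G.Adj v u → Core G u := fun u hu =>
        ⟨fun h => hl u h hu.symm, fun h => hk u h hu⟩
      apply hv.1
      refine ⟨u, fun t => ⟨fun ht => hq'' _ _ ht (hcore _ ht) hu (hcore _ hu), ?_⟩⟩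
      rintro rfl
      exact hu

end Mass

section Chain

variable {V : Type*} [Fintype V] {G : SimpleGraph V} {h : ℕ} {own : V → V} {w : V → ℝ}

/-- A clean core vertex with exactly two core neighbours. -/
structure Lnk (G : SimpleGraph V) (own : V → V) (w : V → ℝ) (a v b : V) : Prop where
  ca : Core G a
  cv : Core G v
  cb : Core G b
  ne : a ≠ b
  va : G.Adj v a
  vb : G.Adj v b
  only : ∀ u, G.Adj v u → Core G u → u = a ∨ u = b
  clean : mm own w v < 1 / 2

theorem Lnk.symm {a v b : V} (L : Lnk G own w a v b) : Lnk G own w b v a :=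
  ⟨L.cb, L.cv, L.ca, L.ne.symm, L.vb, L.va, fun u h1 h2 => (L.only u h1 h2).symm, L.clean⟩

/-- No leaf neighbour. -/
def NoLeaf (G : SimpleGraph V) (v : V) : Prop := ∀ a, G.Adj v a → ¬ Leaf G a

theorem Ctx.lnk_aop (C : Ctx G h own w) {a v b : V} (L : Lnk G own w a v b) (hP : NoLeaf G v)
    (u : V) : Aop G (yv G v) u = ee a u + ee b u := by
  rw [aop_yv C.conn C.card L.cv]
  unfold ee
  by_cases h1 : u = a
  · subst h1
    simp [L.va, L.ca.2, L.ne]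
  · by_cases h2 : u = b
    · subst h2
      simp [L.vb, L.cb.2, h1]
    · have : ¬ (G.Adj v u ∧ ¬ Mid G u) := by
        rintro ⟨h3, h4⟩
        rcases L.only u h3 ⟨hP u h3, h4⟩ with h | h
        · exact h1 h
        · exact h2 h
      simp only [if_neg this, if_neg h1, if_neg h2, add_zero]

theorem Ctx.yv_zero (C : Ctx G h own w) {v u : V} (hv : Core G v) (h : own u ≠ v) :
    yv G v u = 0 := by
  by_contra h0
  exact h (yv_supp C.conn C.card C.own hv h0)

theorem Ctx.caseA (C : Ctx G h own w) {a v b l : V} (L : Lnk G own w a v b) (hP : NoLeaf G v)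
    (hl : Leaf G l) (hlb : G.Adj l b) : 1 / 2 ≤ mm own w v + mm own w b := by
  have hvb : v ≠ b := L.vb.ne
  have hown : own l = b := C.own.adj l b L.cb (fun h => h.1 hl) hlb
  have hlv : l ≠ v := by
    rintro rfl
    exact L.cv.1 hl
  have h1 := C.mass {v, b} (fun u => yv G v u - ee l u) 1 2 (by norm_num) ?_ ?_ ?_
  · rw [Finset.sum_pair hvb] at h1
    linarith
  · intro u hu
    rw [Finset.mem_insert, Finset.mem_singleton]
    by_cases hul : u = l
    · subst hul; exact Or.inr hown
    · left
      by_contra h0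
      apply hu
      rw [C.yv_zero L.cv h0]
      simp [ee, hul]
  · have : ∀ u, Aop G (fun u => yv G v u - ee l u) u ^ 2 = ee a u ^ 2 := by
      intro u
      rw [aop_sub, aop_ee_leaf hl hlb, C.lnk_aop L hP]
      ring
    simp_rw [this, sum_ee_sq]; rfl
  · have e : ∑ u ∈ {v, l}, (yv G v u - ee l u) ^ 2 = 2 := by
      rw [Finset.sum_pair hlv.symm, yv_self, C.yv_zero (u := l) L.cv (by rw [hown]; exact hvb.symm)]
      simp [ee, hlv.symm]
      norm_num
    rw [← e]
    exact Finset.sum_le_sum_of_subset_of_nonneg (Finset.subset_univ _) fun _ _ _ => sq_nonneg _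

theorem Ctx.caseB (C : Ctx G h own w) {a v b l la lb : V} (L : Lnk G own w a v b)
    (hl : Leaf G l) (hlv : G.Adj l v) (hla : Leaf G la) (hlaa : G.Adj la a)
    (hlb : Leaf G lb) (hlbb : G.Adj lb b) :
    1 / 3 ≤ mm own w a + mm own w v + mm own w b := by
  have hva : v ≠ a := L.va.ne
  have hvb : v ≠ b := L.vb.ne
  have o1 : own la = a := C.own.adj la a L.ca (fun h => h.1 hla) hlaa
  have o2 : own lb = b := C.own.adj lb b L.cb (fun h => h.1 hlb) hlbb
  have n1 : v ≠ la := by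
    rintro rfl
    exact L.cv.1 hla
  have n2 : v ≠ lb := by
    rintro rfl
    exact L.cv.1 hlb
  have n3 : la ≠ lb := by
    rintro rfl
    exact L.ne (o1.symm.trans o2)
  have n4 : l ≠ a := by
    rintro rfl
    exact L.ca.1 hl
  have n5 : l ≠ b := by
    rintro rfl
    exact L.cb.1 hl
  have h1 := C.mass {a, v, b} (fun u => ee v u - (ee la u + ee lb u)) 1 3 (by norm_num) ?_ ?_ ?_
  · rw [Finset.sum_insert (by simp [hva.symm, L.ne]), Finset.sum_pair hvb] at h1
    linarith
  · intro u hu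
    simp only [Finset.mem_insert, Finset.mem_singleton]
    unfold ee at hu
    by_cases i1 : u = v
    · subst i1; simp [C.own.self u L.cv]
    · by_cases i2 : u = la
      · subst i2; exact Or.inl o1
      · by_cases i3 : u = lb
        · subst i3; exact Or.inr (Or.inr o2)
        · simp [i1, i2, i3] at hu
  · have : ∀ u, Aop G (fun u => ee v u - (ee la u + ee lb u)) u ^ 2 = ee l u ^ 2 := by
      intro u
      rw [aop_sub, aop_add, aop_ee_leaf hla hlaa, aop_ee_leaf hlb hlbb, aop_ee]
      unfold ee
      by_cases i1 : u = a
      · subst i1; simp [L.va, L.ne, n4.symm]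
      · by_cases i2 : u = b
        · subst i2; simp [L.vb, i1, n5.symm]
        · by_cases i3 : u = l
          · subst i3; simp [hlv.symm, n4, n5]
          · have : ¬ G.Adj v u := by
              intro hvu
              have hc : Core G u := by
                refine ⟨fun hu => ?_, fun hu => ?_⟩
                · exact absurd (C.dirty_two L.cv hu hl i3 hvu.symm hlv) (not_le.2 L.clean)
                · exact absurd (C.dirty_mid L.cv hl hu hlv hvu.symm) (not_le.2 L.clean)
              rcases L.only u hvu hc with h | h
              · exact i1 h
              · exact i2 h
            simp [this, i1, i2, i3]
    simp_rw [this, sum_ee_sq]; rfl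
  · have e : ∑ u ∈ {v, la, lb}, (ee v u - (ee la u + ee lb u)) ^ 2 = 3 := by
      rw [Finset.sum_insert (by simp [n1, n2]), Finset.sum_pair n3]
      simp [ee, n1, n2, n3, n1.symm, n2.symm, n3.symm]
      norm_num
    rw [← e]
    exact Finset.sum_le_sum_of_subset_of_nonneg (Finset.subset_univ _) fun _ _ _ => sq_nonneg _

theorem Ctx.caseC (C : Ctx G h own w) (c : ℕ → V) (hinj : ∀ i ≤ 6, ∀ j ≤ 6, c i = c j → i = j)
    (L1 : Lnk G own w (c 0) (c 1) (c 2)) (L3 : Lnk G own w (c 2) (c 3) (c 4))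
    (L5 : Lnk G own w (c 4) (c 5) (c 6))
    (P1 : NoLeaf G (c 1)) (P3 : NoLeaf G (c 3)) (P5 : NoLeaf G (c 5)) :
    1 / 3 ≤ mm own w (c 1) + mm own w (c 3) + mm own w (c 5) := by
  have n13 : c 1 ≠ c 3 := fun h => by have := hinj _ (by omega) _ (by omega) h; omega
  have n15 : c 1 ≠ c 5 := fun h => by have := hinj _ (by omega) _ (by omega) h; omega
  have n35 : c 3 ≠ c 5 := fun h => by have := hinj _ (by omega) _ (by omega) h; omega
  have n06 : c 0 ≠ c 6 := fun h => by have := hinj _ (by omega) _ (by omega) h; omega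
  have o1 := C.own.self _ L1.cv
  have o3 := C.own.self _ L3.cv
  have o5 := C.own.self _ L5.cv
  have h1 := C.mass {c 1, c 3, c 5}
    (fun u => (yv G (c 1) u - yv G (c 3) u) + yv G (c 5) u) 2 3 (by norm_num) ?_ ?_ ?_
  · rw [Finset.sum_insert (by simp [n13, n15]), Finset.sum_pair n35] at h1
    linarith
  · intro u hu
    simp only [Finset.mem_insert, Finset.mem_singleton]
    by_contra hcon
    push Not at hcon
    apply hu
    rw [C.yv_zero L1.cv hcon.1, C.yv_zero L3.cv hcon.2.1, C.yv_zero L5.cv hcon.2.2]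
    ring
  · have : ∀ u, Aop G (fun u => (yv G (c 1) u - yv G (c 3) u) + yv G (c 5) u) u ^ 2
        = ee (c 0) u ^ 2 + ee (c 6) u ^ 2 := by
      intro u
      rw [aop_add, aop_sub, C.lnk_aop L1 P1, C.lnk_aop L3 P3, C.lnk_aop L5 P5]
      have : ee (c 0) u * ee (c 6) u = 0 := by
        unfold ee
        by_cases h0 : u = c 0
        · subst h0; simp [n06]
        · simp [h0]
      linear_combination 2 * this
    simp_rw [this]
    rw [Finset.sum_add_distrib, sum_ee_sq, sum_ee_sq]
    norm_num
  · have e : ∑ u ∈ {c 1, c 3, c 5}, ((yv G (c 1) u - yv G (c 3) u) + yv G (c 5) u) ^ 2 = 3 := by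
      rw [Finset.sum_insert (by simp [n13, n15]), Finset.sum_pair n35, yv_self, yv_self, yv_self,
        C.yv_zero (u := c 1) L3.cv (by rw [o1]; exact n13),
        C.yv_zero (u := c 1) L5.cv (by rw [o1]; exact n15),
        C.yv_zero (u := c 3) L1.cv (by rw [o3]; exact n13.symm),
        C.yv_zero (u := c 3) L5.cv (by rw [o3]; exact n35),
        C.yv_zero (u := c 5) L1.cv (by rw [o5]; exact n15.symm),
        C.yv_zero (u := c 5) L3.cv (by rw [o5]; exact n35.symm)]
      norm_num
    rw [← e]
    exact Finset.sum_le_sum_of_subset_of_nonneg (Finset.subset_univ _) fun _ _ _ => sq_nonneg _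

theorem Ctx.chain (C : Ctx G h own w) (c : ℕ → V) (hinj : ∀ i ≤ 6, ∀ j ≤ 6, c i = c j → i = j)
    (hL : ∀ i ≤ 4, Lnk G own w (c i) (c (i + 1)) (c (i + 2))) :
    1 / 3 ≤ ∑ i ∈ Finset.range 7, mm own w (c i) := by
  have e : ∑ i ∈ Finset.range 7, mm own w (c i) = mm own w (c 0) + mm own w (c 1)
      + mm own w (c 2) + mm own w (c 3) + mm own w (c 4) + mm own w (c 5) + mm own w (c 6) := by
    simp only [Finset.sum_range_succ, Finset.sum_range_zero, zero_add]
  rw [e]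
  have p0 := C.mm_nonneg (c 0)
  have p1 := C.mm_nonneg (c 1)
  have p2 := C.mm_nonneg (c 2)
  have p3 := C.mm_nonneg (c 3)
  have p4 := C.mm_nonneg (c 4)
  have p5 := C.mm_nonneg (c 5)
  have p6 := C.mm_nonneg (c 6)
  have L0 : Lnk G own w (c 0) (c 1) (c 2) := hL 0 (by omega)
  have L1 : Lnk G own w (c 1) (c 2) (c 3) := hL 1 (by omega)
  have L2 : Lnk G own w (c 2) (c 3) (c 4) := hL 2 (by omega)
  have L3 : Lnk G own w (c 3) (c 4) (c 5) := hL 3 (by omega)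
  have L4 : Lnk G own w (c 4) (c 5) (c 6) := hL 4 (by omega)
  have lf : ∀ v, ¬ NoLeaf G v → ∃ l, Leaf G l ∧ G.Adj l v := by
    intro v hv
    unfold NoLeaf at hv
    push Not at hv
    obtain ⟨l, h1, h2⟩ := hv
    exact ⟨l, h2, h1.symm⟩
  have A : ∀ a v b, Lnk G own w a v b → NoLeaf G v → ¬ NoLeaf G b →
      1 / 2 ≤ mm own w v + mm own w b := by
    intro a v b L hP hb
    obtain ⟨l, hl, hlb⟩ := lf b hb
    exact C.caseA L hP hl hlb
  by_cases q1 : NoLeaf G (c 1)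
  · by_cases q2 : NoLeaf G (c 2)
    · by_cases q3 : NoLeaf G (c 3)
      · by_cases q4 : NoLeaf G (c 4)
        · by_cases q5 : NoLeaf G (c 5)
          · have := C.caseC c hinj L0 L2 L4 q1 q3 q5
            linarith
          · have := A _ _ _ L3 q4 q5
            linarith
        · have := A _ _ _ L2 q3 q4
          linarith
      · have := A _ _ _ L1 q2 q3
        linarith
    · have := A _ _ _ L0 q1 q2
      linarith
  · by_cases q2 : NoLeaf G (c 2)
    · have := A _ _ _ L1.symm q2 q1
      linarith
    · by_cases q3 : NoLeaf G (c 3)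
      · have := A _ _ _ L2.symm q3 q2
        linarith
      · obtain ⟨l1, h1, h1'⟩ := lf _ q1
        obtain ⟨l2, h2, h2'⟩ := lf _ q2
        obtain ⟨l3, h3, h3'⟩ := lf _ q3
        have := C.caseB L1 h2 h2' h1 h1' h3 h3'
        linarith

end Chain

section CoreBound

variable {V : Type*} [Fintype V] {G : SimpleGraph V} {h : ℕ} {own : V → V} {w : V → ℝ}

/-- The parent of a core vertex is core when the root is core. -/
theorem Rooted.core_parent {r : V} {p : V → V} {dep : V → ℕ} (R : Rooted G r p dep)
    (hr : Core G r) {v : V} (hv : Core G v) (hvr : v ≠ r) : Core G (p v) := by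
  have h1 := R.par v hvr
  have d1 := R.dpt v hvr
  by_cases hpr : p v = r
  · rw [hpr]; exact hr
  have h2 := R.par _ hpr
  have d2 := R.dpt _ hpr
  have hne : p (p v) ≠ v := by
    intro h
    rw [h] at d2
    omega
  refine ⟨fun hl => hne (hl.unique h2 h1.symm), ?_⟩
  rintro ⟨b, c, hbc, hb, hu⟩
  have hvc : v = c := by
    rcases (hu v).1 h1.symm with h | h
    · subst h; exact absurd hb hv.1
    · exact h
  have hpb : p (p v) = b := by
    rcases (hu _).1 h2 with h | h
    · exact h
    · exact absurd (h.trans hvc.symm) hne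
  have hbr : b ≠ r := by
    rintro rfl
    exact hr.1 hb
  have h3 := R.par b hbr
  have d3 := R.dpt b hbr
  have := hb.unique h3 ((hu b).2 (Or.inl rfl)).symm
  rw [this] at d3
  rw [hpb] at d2
  omega

/-- Good vertices. -/
def Good (G : SimpleGraph V) (own : V → V) (w : V → ℝ) (r v : V) : Prop :=
  Core G v ∧ v ≠ r ∧ mm own w v < 1 / 2 ∧ (cn G v).card = 2

/-- Iterated good set. -/
def ZZ (G : SimpleGraph V) (own : V → V) (w : V → ℝ) (r : V) (p : V → V) : ℕ → V → Prop
  | 0, v => Good G own w r v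
  | (i + 1), v => Good G own w r v ∧ ZZ G own w r p i (p v)

theorem ZZ.good {r : V} {p : V → V} {i : ℕ} {v : V} (hz : ZZ G own w r p i v) :
    ∀ j ≤ i, Good G own w r (p^[j] v) := by
  induction i generalizing v with
  | zero =>
    intro j hj
    have : j = 0 := by omega
    subst this
    exact hz
  | succ i ih =>
    intro j hj
    cases j with
    | zero => exact hz.1
    | succ j =>
      rw [Function.iterate_succ_apply]
      exact ih hz.2 j (by omega)

theorem Rooted.good_unique {r : V} {p : V → V} {dep : V → ℕ} (R : Rooted G r p dep)
    (hr : Core G r) {u v a : V} (hu : Good G own w r u) (hv : Core G v) (hvr : v ≠ r)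
    (hpv : p v = u) (ha : G.Adj u a) (hac : Core G a) : a = v ∨ a = p u := by
  obtain ⟨huc, hur, -, hq⟩ := hu
  have h1 : G.Adj u v := by
    have := R.par v hvr
    rw [hpv] at this
    exact this.symm
  have h2 := R.par u hur
  have h3 := R.core_parent hr huc hur
  have hne : v ≠ p u := by
    intro h
    have d1 := R.dpt v hvr
    have d2 := R.dpt u hur
    rw [hpv] at d1
    rw [← h] at d2
    omega
  have hsub : ({v, p u} : Finset V) ⊆ cn G u := by
    intro x hx
    simp only [Finset.mem_insert, Finset.mem_singleton] at hx
    simp only [cn, Finset.mem_filter, Finset.mem_univ, true_and]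
    rcases hx with rfl | rfl
    · exact ⟨h1, hv⟩
    · exact ⟨h2, h3⟩
  have heq := Finset.eq_of_subset_of_card_le hsub (by rw [hq, Finset.card_pair hne])
  have hmem : a ∈ cn G u := by simp [cn, ha, hac]
  rw [← heq] at hmem
  simpa using hmem

theorem Rooted.iter_dep {r : V} {p : V → V} {dep : V → ℕ} (R : Rooted G r p dep) {v : V} {k : ℕ}
    (hk : ∀ j ≤ k, p^[j] v ≠ r) : ∀ j ≤ k, dep (p^[j] v) + j = dep v := by
  intro j
  induction j with
  | zero => intro _; rfl
  | succ j ih =>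
    intro hj
    have h1 := ih (by omega)
    have h2 := R.dpt _ (hk j (by omega))
    rw [Function.iterate_succ_apply']
    omega

theorem Ctx.core_card (C : Ctx G h own w) :
    (Finset.univ.filter (fun v => Core G v)).card ≤ 1291 * h + 127 := by
  set K := Finset.univ.filter (fun v => Core G v) with hK
  have memK : ∀ v, v ∈ K ↔ Core G v := by intro v; simp [hK]
  have hne : Nonempty V := C.conn.nonempty
  obtain ⟨v0⟩ := hne
  obtain ⟨r, hr⟩ : ∃ r, Core G r := ⟨own v0, C.own.core v0⟩
  obtain ⟨p, dep, R⟩ := exists_rooted C.tree r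
  set ch : V → Finset V := fun v => Finset.univ.filter (fun u => (u ≠ r ∧ Core G u) ∧ p u = v)
    with hch
  have hchT : ∀ T : Finset V, ∑ v ∈ T, (ch v).card
      = (Finset.univ.filter (fun u => (u ≠ r ∧ Core G u) ∧ p u ∈ T)).card := by
    intro T
    rw [Finset.card_eq_sum_card_fiberwise (f := p) (t := T)]
    · refine Finset.sum_congr rfl fun v hv => ?_
      congr 1
      ext u
      simp only [hch, Finset.mem_filter, Finset.mem_univ, true_and]
      constructor
      · rintro ⟨h1, h2⟩; exact ⟨⟨h1, h2 ▸ hv⟩, h2⟩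
      · rintro ⟨⟨h1, _⟩, h2⟩; exact ⟨h1, h2⟩
    · intro u hu
      simp only [Finset.coe_filter, Finset.mem_univ, true_and, Set.mem_setOf_eq] at hu
      exact hu.2
  have hchq : ∀ v, (ch v).card ≤ (cn G v).card := by
    intro v
    refine Finset.card_le_card ?_
    intro u hu
    simp only [hch, cn, Finset.mem_filter, Finset.mem_univ, true_and] at hu ⊢
    have := R.par u hu.1.1
    rw [hu.2] at this
    exact ⟨this.symm, hu.1.2⟩
  have hqch : ∀ v, (cn G v).card ≤ 1 + (ch v).card := by
    intro v
    have : cn G v ⊆ insert (p v) (ch v) := by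
      intro u hu
      simp only [hch, cn, Finset.mem_filter, Finset.mem_univ, true_and, Finset.mem_insert] at hu ⊢
      rcases R.adj _ _ hu.1 with h | h
      · exact Or.inl h.2.symm
      · exact Or.inr ⟨⟨h.1, hu.2⟩, h.2⟩
    have h1 := Finset.card_le_card this
    have h2 := Finset.card_insert_le (p v) (ch v)
    omega
  have hsumq : ∑ v ∈ K, (cn G v).card ≤ 2 * K.card := by
    have h1 : ∑ v ∈ K, (ch v).card ≤ K.card := by
      rw [hchT]
      refine Finset.card_le_card ?_
      intro u hu
      simp only [Finset.mem_filter, Finset.mem_univ, true_and] at hu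
      exact (memK u).2 hu.1.2
    have h2 : ∑ v ∈ K, (cn G v).card ≤ ∑ v ∈ K, (1 + (ch v).card) :=
      Finset.sum_le_sum fun v _ => hqch v
    rw [Finset.sum_add_distrib] at h2
    simp only [Finset.sum_const, smul_eq_mul, mul_one] at h2
    omega
  have hhalf := C.card_half
  have hdef : ∑ v ∈ K, (2 - (cn G v).card) ≤ 4 * h := by
    have h1 : ∑ v ∈ K, (2 - (cn G v).card)
        ≤ ∑ v ∈ K, (if 1 / 2 ≤ mm own w v then 2 else 0) := by
      refine Finset.sum_le_sum fun v hv => ?_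
      by_cases hv2 : 1 / 2 ≤ mm own w v
      · rw [if_pos hv2]; omega
      · rw [if_neg hv2]
        have : ¬ (cn G v).card ≤ 1 := fun h => hv2 (C.low ((memK v).1 hv) h)
        omega
    rw [← Finset.sum_filter, Finset.sum_const, smul_eq_mul] at h1
    have h2 : (K.filter (fun v => 1 / 2 ≤ mm own w v)).card
        ≤ (Finset.univ.filter (fun v => 1 / 2 ≤ mm own w v)).card :=
      Finset.card_le_card (Finset.filter_subset_filter _ (Finset.subset_univ _))
    omega
  have hexc : ∑ v ∈ K, ((cn G v).card - 2) ≤ 4 * h := by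
    have h1 : ∑ v ∈ K, ((cn G v).card + (2 - (cn G v).card))
        = ∑ v ∈ K, (2 + ((cn G v).card - 2)) :=
      Finset.sum_congr rfl fun v _ => by omega
    rw [Finset.sum_add_distrib, Finset.sum_add_distrib, Finset.sum_const, smul_eq_mul] at h1
    omega
  have hbig : (K.filter (fun v => 3 ≤ (cn G v).card)).card ≤ 4 * h := by
    refine le_trans ?_ hexc
    rw [Finset.card_filter]
    refine Finset.sum_le_sum fun v _ => ?_
    split_ifs <;> omega
  have hNG : (K.filter (fun v => ¬ Good G own w r v)).card ≤ 6 * h + 1 := by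
    have hsub : K.filter (fun v => ¬ Good G own w r v) ⊆
        insert r (Finset.univ.filter (fun v => 1 / 2 ≤ mm own w v)
          ∪ K.filter (fun v => 3 ≤ (cn G v).card)) := by
      intro v hv
      simp only [Finset.mem_filter, Finset.mem_insert, Finset.mem_union, Finset.mem_univ,
        true_and] at hv ⊢
      by_contra hcon
      push Not at hcon
      obtain ⟨c1, c2, c3⟩ := hcon
      have c4 := c3 hv.1
      have c5 : ¬ (cn G v).card ≤ 1 := fun h => by
        have := C.low ((memK v).1 hv.1) h
        linarith
      exact hv.2 ⟨(memK v).1 hv.1, c1, c2, by omega⟩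
    have h1 := Finset.card_le_card hsub
    have h2 := Finset.card_insert_le r (Finset.univ.filter (fun v => 1 / 2 ≤ mm own w v)
          ∪ K.filter (fun v => 3 ≤ (cn G v).card))
    have h3 := Finset.card_union_le (Finset.univ.filter (fun v => 1 / 2 ≤ mm own w v))
          (K.filter (fun v => 3 ≤ (cn G v).card))
    omega
  have hstep : ∀ i, (K.filter (fun v => ¬ ZZ G own w r p (i + 1) v)).card
      ≤ (10 * h + 1) + 2 * (K.filter (fun v => ¬ ZZ G own w r p i v)).card := by
    intro i
    set T := K.filter (fun v => ¬ ZZ G own w r p i v) with hT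
    have hsub : K.filter (fun v => ¬ ZZ G own w r p (i + 1) v) ⊆
        K.filter (fun v => ¬ Good G own w r v)
          ∪ Finset.univ.filter (fun u => (u ≠ r ∧ Core G u) ∧ p u ∈ T) := by
      intro v hv
      simp only [Finset.mem_filter, Finset.mem_union, Finset.mem_univ, true_and] at hv ⊢
      by_cases hg : Good G own w r v
      · right
        refine ⟨⟨hg.2.1, hg.1⟩, ?_⟩
        simp only [hT, Finset.mem_filter]
        refine ⟨(memK _).2 (R.core_parent hr hg.1 hg.2.1), fun hz => hv.2 ⟨hg, hz⟩⟩
      · exact Or.inl ⟨hv.1, hg⟩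
    have h1 := Finset.card_le_card hsub
    have h2 := Finset.card_union_le (K.filter (fun v => ¬ Good G own w r v))
          (Finset.univ.filter (fun u => (u ≠ r ∧ Core G u) ∧ p u ∈ T))
    rw [← hchT] at h2
    have h3 : ∑ v ∈ T, (ch v).card ≤ ∑ v ∈ T, (2 + ((cn G v).card - 2)) :=
      Finset.sum_le_sum fun v _ => by have := hchq v; omega
    rw [Finset.sum_add_distrib, Finset.sum_const, smul_eq_mul] at h3
    have h4 : ∑ v ∈ T, ((cn G v).card - 2) ≤ ∑ v ∈ K, ((cn G v).card - 2) :=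
      Finset.sum_le_sum_of_subset (Finset.filter_subset _ _)
    omega
  have hz0 : (K.filter (fun v => ¬ ZZ G own w r p 0 v)).card ≤ 6 * h + 1 := hNG
  have hz1 := hstep 0
  have hz2 := hstep 1
  have hz3 := hstep 2
  have hz4 := hstep 3
  have hz5 := hstep 4
  have hz6 := hstep 5
  simp only [zero_add, Nat.reduceAdd] at hz1 hz2 hz3 hz4 hz5 hz6
  set Z := K.filter (fun v => ZZ G own w r p 6 v) with hZ
  have hZgood : ∀ v ∈ Z, ∀ j ≤ 6, Good G own w r (p^[j] v) := by
    intro v hv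
    simp only [hZ, Finset.mem_filter] at hv
    exact hv.2.good
  have hZinj : ∀ i ≤ 6, Set.InjOn (fun v => p^[i] v) Z := by
    intro i
    induction i with
    | zero => intro _ a _ b _ hab; exact hab
    | succ i ih =>
      intro hi a ha b hb hab
      apply ih (by omega) ha hb
      show p^[i] a = p^[i] b
      have hab' : p^[i + 1] a = p^[i + 1] b := hab
      have ga := hZgood a ha
      have gb := hZgood b hb
      have ea : p (p^[i] a) = p^[i + 1] a := (Function.iterate_succ_apply' _ _ _).symm
      have eb : p (p^[i] b) = p^[i + 1] a := by
        rw [hab']; exact (Function.iterate_succ_apply' _ _ _).symm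
      have hA := ga i (by omega)
      have hB := gb i (by omega)
      have hpar := R.par _ hB.2.1
      rw [eb] at hpar
      rcases R.good_unique hr (ga (i + 1) hi) hA.1 hA.2.1 ea hpar.symm hB.1 with h | h
      · exact h.symm
      · exfalso
        have d1 := R.dpt _ hB.2.1
        have d2 := R.dpt _ (ga (i + 1) hi).2.1
        rw [eb] at d1
        rw [← h] at d2
        omega
  have hZmass : ∀ v ∈ Z, (1 : ℝ) / 3 ≤ ∑ i ∈ Finset.range 7, mm own w (p^[i] v) := by
    intro v hv
    have g := hZgood v hv
    have hd := R.iter_dep (v := v) (k := 6) (fun j hj => (g j hj).2.1)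
    refine C.chain (fun i => p^[i] v) ?_ ?_
    · intro i hi j hj hij
      have h1 := hd i hi
      have h2 := hd j hj
      have hij' : p^[i] v = p^[j] v := hij
      rw [hij'] at h1
      omega
    · intro i hi
      have g0 := g i (by omega)
      have g1 := g (i + 1) (by omega)
      have g2 := g (i + 2) (by omega)
      have e1 : p (p^[i] v) = p^[i + 1] v := (Function.iterate_succ_apply' _ _ _).symm
      have e2 : p (p^[i + 1] v) = p^[i + 2] v := (Function.iterate_succ_apply' _ _ _).symm
      have a1 := R.par _ g0.2.1
      rw [e1] at a1
      have a2 := R.par _ g1.2.1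
      rw [e2] at a2
      refine ⟨g0.1, g1.1, g2.1, ?_, a1.symm, a2, ?_, g1.2.2.1⟩
      · intro hij
        have h1 := hd i (by omega)
        have h2 := hd (i + 2) (by omega)
        have hij' : p^[i] v = p^[i + 2] v := hij
        rw [hij'] at h1
        omega
      · intro u hu huc
        have := R.good_unique hr g1 g0.1 g0.2.1 e1 hu huc
        rw [e2] at this
        exact this
  have hZcard : Z.card ≤ 21 * h := by
    have h1 := Finset.card_nsmul_le_sum Z _ _ hZmass
    rw [Finset.sum_comm, nsmul_eq_mul] at h1
    have h2 : ∀ i ∈ Finset.range 7, ∑ v ∈ Z, mm own w (p^[i] v) ≤ h := by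
      intro i hi
      have hi' : i ≤ 6 := by have := Finset.mem_range.1 hi; omega
      have := Finset.sum_image (f := mm own w) (hZinj i hi')
      rw [← this]
      exact C.mm_sum _
    have h3 := Finset.sum_le_card_nsmul _ _ _ h2
    rw [Finset.card_range, nsmul_eq_mul] at h3
    push_cast at h3
    have : (Z.card : ℝ) ≤ 21 * h := by linarith
    exact_mod_cast this
  have hsplit := Finset.card_filter_add_card_filter_not (s := K) (fun v => ZZ G own w r p 6 v)
  rw [← hZ] at hsplit
  omega

end CoreBound

section Degree

variable {V : Type*} [Fintype V] {G : SimpleGraph V} {h : ℕ} {own : V → V} {w : V → ℝ}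

/-- Degree. -/
noncomputable def dg (G : SimpleGraph V) (v : V) : ℕ :=
  (Finset.univ.filter (fun u => G.Adj v u)).card

/-- Middle neighbours. -/
noncomputable def km (G : SimpleGraph V) (v : V) : Finset V :=
  Finset.univ.filter (fun u => G.Adj v u ∧ Mid G u)

/-- Other neighbours. -/
noncomputable def nm (G : SimpleGraph V) (v : V) : Finset V :=
  Finset.univ.filter (fun u => G.Adj v u ∧ ¬ Mid G u)

theorem dg_eq (v : V) : dg G v = (km G v).card + (nm G v).card := by
  unfold dg km nm
  rw [← Finset.card_filter_add_card_filter_not (s := Finset.univ.filter (fun u => G.Adj v u))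
    (fun u => Mid G u), Finset.filter_filter, Finset.filter_filter]

theorem aop_eq (x : V → ℝ) (v : V) : Aop G x v = ∑ u ∈ km G v, x u + ∑ u ∈ nm G v, x u := by
  unfold Aop km nm
  rw [← Finset.sum_filter_add_sum_filter_not (Finset.univ.filter (fun u => G.Adj v u))
    (fun u => Mid G u), Finset.filter_filter, Finset.filter_filter]

theorem Ctx.nm_card (C : Ctx G h own w) (v : V) : (nm G v).card ≤ 1293 * h + 128 := by
  have hsub : nm G v ⊆ Finset.univ.filter (fun v => Core G v)
      ∪ Finset.univ.filter (fun a => G.Adj v a ∧ Leaf G a) := by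
    intro u hu
    simp only [nm, Finset.mem_filter, Finset.mem_union, Finset.mem_univ, true_and] at hu ⊢
    by_cases hl : Leaf G u
    · exact Or.inr ⟨hu.1, hl⟩
    · exact Or.inl ⟨hl, hu.2⟩
  have h1 := Finset.card_le_card hsub
  have h2 := Finset.card_union_le (Finset.univ.filter (fun v => Core G v))
    (Finset.univ.filter (fun a => G.Adj v a ∧ Leaf G a))
  have h3 := C.core_card
  have h4 := C.leaf_card v
  omega

theorem dg_noncore {v : V} (hv : ¬ Core G v) : dg G v ≤ 2 := by
  unfold dg
  by_cases hl : Leaf G v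
  · obtain ⟨a, ha⟩ := hl
    have : Finset.univ.filter (fun u => G.Adj v u) = {a} := by ext u; simp [ha]
    rw [this]; simp
  · have hm : Mid G v := by
      by_contra hm
      exact hv ⟨hl, hm⟩
    obtain ⟨b, c, hbc, hb, hu⟩ := hm
    have : Finset.univ.filter (fun u => G.Adj v u) = {b, c} := by ext u; simp [hu]
    rw [this]
    exact Finset.card_le_two

variable {b : ℕ}

/-- A heavy vertex supports a null vector. -/
theorem Ctx.heavy_null (C : Ctx G h own w) (F : Facts G h) {v : V} (hv : Core G v)
    (hb : (nm G v).card ≤ b) (hk : b ≤ (km G v).card) :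
    ∃ z : V → ℝ, (∀ u, Aop G z u = 0) ∧ z v ≠ 0 := by
  have h1 : ∑ u, Aop G (yv G v) u ^ 2 = (nm G v).card := by
    have : ∀ u, Aop G (yv G v) u ^ 2 = if u ∈ nm G v then 1 else 0 := by
      intro u
      rw [aop_yv C.conn C.card hv]
      simp only [nm, Finset.mem_filter, Finset.mem_univ, true_and]
      split_ifs <;> norm_num
    simp_rw [this]
    rw [Finset.sum_ite_mem, Finset.univ_inter, Finset.sum_const, nsmul_eq_mul, mul_one]
  have h2 := yv_norm C.conn C.card hv
  have h3 : ((nm G v).card : ℝ) ≤ (km G v).card := by exact_mod_cast hb.trans hk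
  obtain ⟨z, hz, hzy⟩ := F.nullv (yv G v) (by
    rw [h1]
    unfold km at h3
    linarith)
  refine ⟨z, hz, fun h0 => hzy ?_⟩
  refine Finset.sum_eq_zero fun u _ => ?_
  unfold yv
  by_cases huv : u = v
  · subst huv; rw [h0]; simp
  · rw [if_neg huv]
    by_cases hex : ∃ a, Mid G a ∧ G.Adj v a ∧ G.Adj a u
    · obtain ⟨a, ha, hva, hau⟩ := hex
      obtain ⟨c, hcv, hc, hu⟩ := ha.leaf C.conn C.card hv hva.symm
      have huc : u = c := by
        rcases (hu u).1 hau with h | h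
        · exact h
        · exact absurd h huv
      subst huc
      have := hz a
      unfold Aop at this
      have e : Finset.univ.filter (fun t => G.Adj a t) = {u, v} := by ext t; simp [hu]
      rw [e, Finset.sum_pair huv, h0, add_zero] at this
      rw [this]; simp
    · rw [if_neg hex]; simp

theorem null_leaf {z : V → ℝ} (hz : ∀ u, Aop G z u = 0) {l v : V} (hl : Leaf G l)
    (hlv : G.Adj l v) : z v = 0 := by
  have := hz l
  unfold Aop at this
  have e : Finset.univ.filter (fun t => G.Adj l t) = {v} := by ext t; simp [hl.adj_iff hlv]
  rw [e, Finset.sum_singleton] at this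
  exact this

theorem Ctx.heavy_noleaf (C : Ctx G h own w) (F : Facts G h) {v : V} (hv : Core G v)
    (hb : (nm G v).card ≤ b) (hk : b ≤ (km G v).card) {l : V} (hvl : G.Adj v l) :
    ¬ Leaf G l := by
  intro hl
  obtain ⟨z, hz, hzv⟩ := C.heavy_null F hv hb hk
  exact hzv (null_leaf hz hl hvl.symm)

theorem Ctx.heavy_light (C : Ctx G h own w) (F : Facts G h) (hb : ∀ v, (nm G v).card ≤ b)
    {v u : V} (hv : Core G v) (hk : b ≤ (km G v).card) (hu : u ∈ nm G v) :
    Core G u ∧ (km G u).card < b := by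
  simp only [nm, Finset.mem_filter, Finset.mem_univ, true_and] at hu
  have huc : Core G u := ⟨C.heavy_noleaf F hv (hb v) hk hu.1, hu.2⟩
  refine ⟨huc, ?_⟩
  by_contra hcon
  push Not at hcon
  obtain ⟨z, hz, hzv⟩ := C.heavy_null F hv (hb v) hk
  obtain ⟨y, hy, hyu⟩ := C.heavy_null F huc (hb u) hcon
  exact null_adj C.tree hu.1 hz hy hzv hyu

/-- There is no eigenvalue that is too large. -/
theorem Ctx.no_top (C : Ctx G h own w) (F : Facts G h) (hb : ∀ v, (nm G v).card ≤ b)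
    {d j L : ℕ} (hd : ∀ v, dg G v ≤ d) (hj : j ^ 2 = d + 1) (hjb : 2 * b ^ 2 + 2 * b + 1 ≤ j)
    (hL : j + 1 ≤ L) (z : V → ℝ) (hz0 : z ≠ 0) (hz : ∀ v, Aop G z v = L * z v) : False := by
  have hL2 : 2 ≤ L := by omega
  have hLr : (2 : ℝ) ≤ L := by exact_mod_cast hL2
  have hLL : (0 : ℝ) < (L : ℝ) ^ 2 - 1 := by nlinarith
  have hleaf : ∀ l v, Leaf G l → G.Adj l v → L * z l = z v := by
    intro l v hl hlv
    have := hz l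
    unfold Aop at this
    have e : Finset.univ.filter (fun t => G.Adj l t) = {v} := by ext t; simp [hl.adj_iff hlv]
    rw [e, Finset.sum_singleton] at this
    exact this.symm
  have hmid : ∀ a v, Mid G a → Core G v → G.Adj a v → ((L : ℝ) ^ 2 - 1) * z a = L * z v := by
    intro a v ha hv hav
    obtain ⟨c, hcv, hc, hu⟩ := ha.leaf C.conn C.card hv hav
    have h1 := hz a
    unfold Aop at h1
    have e : Finset.univ.filter (fun t => G.Adj a t) = {c, v} := by ext t; simp [hu]
    rw [e, Finset.sum_pair hcv] at h1
    have h2 := hleaf c a hc ((hu c).2 (Or.inl rfl)).symm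
    linear_combination (-(L : ℝ)) * h1 + h2
  set K := Finset.univ.filter (fun v => Core G v) with hK
  have hKne : K.Nonempty := by
    obtain ⟨v0⟩ := C.conn.nonempty
    exact ⟨own v0, by simp [hK, C.own.core v0]⟩
  obtain ⟨v, hvK, hmax⟩ := Finset.exists_max_image K (fun v => |z v|) hKne
  have hv : Core G v := by simpa [hK] using hvK
  set M := |z v| with hM
  have hM0 : 0 ≤ M := abs_nonneg _
  have hcore : ∀ u, Core G u → |z u| ≤ M := fun u hu => hmax u (by simpa [hK] using hu)
  have hmidle : ∀ a, Mid G a → |z a| ≤ M := by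
    intro a ha
    obtain ⟨c, u, hcu, hc, hu, hh⟩ := ha.exists C.conn C.card
    have h1 := hmid a u ha hu ((hh u).2 (Or.inr rfl))
    have h2 := congrArg abs h1
    rw [abs_mul, abs_mul, abs_of_pos hLL, abs_of_nonneg (by linarith : (0 : ℝ) ≤ L)] at h2
    have h3 := hcore u hu
    have h4 : 0 ≤ |z a| := abs_nonneg _
    by_contra hcon
    push Not at hcon
    have h5 : (L : ℝ) * |z u| ≤ L * M := mul_le_mul_of_nonneg_left h3 (by linarith)
    have h6 : ((L : ℝ) ^ 2 - 1) * M < ((L : ℝ) ^ 2 - 1) * |z a| :=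
      mul_lt_mul_of_pos_left hcon hLL
    have h7 : (L : ℝ) * M ≤ ((L : ℝ) ^ 2 - 1) * M :=
      mul_le_mul_of_nonneg_right (by nlinarith) hM0
    linarith
  have hleafaux : ∀ u, Leaf G u → ∀ a, G.Adj u a → |z a| ≤ M → |z u| ≤ M := by
    intro u hu a hua ha
    have h1 := hleaf u a hu hua
    have h2 := congrArg abs h1
    rw [abs_mul, abs_of_nonneg (by linarith : (0 : ℝ) ≤ L)] at h2
    have h4 : 0 ≤ |z u| := abs_nonneg _
    nlinarith
  have hall : ∀ u, |z u| ≤ M := by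
    intro u
    by_cases hu : Core G u
    · exact hcore u hu
    by_cases hm : Mid G u
    · exact hmidle u hm
    have hl : Leaf G u := by
      by_contra hl
      exact hu ⟨hl, hm⟩
    obtain ⟨a, hua⟩ := C.exists_adj u
    refine hleafaux u hl a hua ?_
    by_cases hma : Mid G a
    · exact hmidle a hma
    · exact hcore a ⟨not_leaf_leaf C.conn C.card hl hua, hma⟩
  have hMpos : 0 < M := by
    rcases hM0.lt_or_eq with h1 | h1
    · exact h1
    · exfalso
      apply hz0
      funext u
      have := hall u
      rw [← h1] at this
      exact abs_eq_zero.1 (le_antisymm this (abs_nonneg _))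
  have hlight : ∀ u, (km G u).card < b → L * |z u| ≤ 2 * b * M := by
    intro u hu
    have h1 := hz u
    have h2 : |Aop G z u| ≤ (dg G u : ℝ) * M := by
      unfold Aop dg
      refine (Finset.abs_sum_le_sum_abs _ _).trans ?_
      rw [← nsmul_eq_mul]
      exact Finset.sum_le_card_nsmul _ _ _ fun t _ => hall t
    rw [h1, abs_mul, abs_of_nonneg (by linarith : (0 : ℝ) ≤ L)] at h2
    have h3 : dg G u ≤ 2 * b := by
      rw [dg_eq]
      have := hb u
      omega
    have h4 : (dg G u : ℝ) ≤ 2 * b := by exact_mod_cast h3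
    nlinarith
  by_cases hlv : (km G v).card < b
  · have h1 := hlight v hlv
    rw [← hM] at h1
    have h2 : (L : ℝ) ≤ 2 * b := le_of_mul_le_mul_right h1 hMpos
    have h3 : L ≤ 2 * b := by exact_mod_cast h2
    nlinarith
  · push Not at hlv
    have h1 := hz v
    rw [aop_eq] at h1
    have h2 : ((L : ℝ) ^ 2 - 1) * ∑ a ∈ km G v, z a = (km G v).card * (L * z v) := by
      rw [Finset.mul_sum, ← nsmul_eq_mul, ← Finset.sum_const]
      refine Finset.sum_congr rfl fun a ha => ?_
      simp only [km, Finset.mem_filter, Finset.mem_univ, true_and] at ha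
      exact hmid a v ha.2 hv ha.1.symm
    have h3 : (L : ℝ) * |∑ a ∈ nm G v, z a| ≤ b * (2 * b * M) := by
      calc (L : ℝ) * |∑ a ∈ nm G v, z a| ≤ L * ∑ a ∈ nm G v, |z a| :=
            mul_le_mul_of_nonneg_left (Finset.abs_sum_le_sum_abs _ _) (by linarith)
        _ = ∑ a ∈ nm G v, L * |z a| := Finset.mul_sum _ _ _
        _ ≤ (nm G v).card • (2 * b * M) := Finset.sum_le_card_nsmul _ _ _ fun a ha =>
            hlight a (C.heavy_light F hb hv hlv ha).2
        _ ≤ b * (2 * b * M) := by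
            rw [nsmul_eq_mul]
            have : ((nm G v).card : ℝ) ≤ b := by exact_mod_cast hb v
            exact mul_le_mul_of_nonneg_right this (by positivity)
    have h4 : ((L : ℝ) ^ 2 - 1 - (km G v).card) * L * z v
        = ((L : ℝ) ^ 2 - 1) * ∑ a ∈ nm G v, z a := by
      linear_combination (-((L : ℝ) ^ 2 - 1)) * h1 + h2
    have hkd : (km G v).card ≤ d := by
      have := hd v
      rw [dg_eq] at this
      omega
    have hLd : 2 * j + 1 + (km G v).card + 1 ≤ L ^ 2 := by nlinarith
    have hLd' : (2 : ℝ) * j + 1 + (km G v).card + 1 ≤ (L : ℝ) ^ 2 := by exact_mod_cast hLd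
    have hpos : 0 ≤ (L : ℝ) ^ 2 - 1 - (km G v).card := by
      have : (0 : ℝ) ≤ j := Nat.cast_nonneg _
      linarith
    have h5 := congrArg abs h4
    rw [abs_mul, abs_mul, abs_mul, abs_of_nonneg hpos, abs_of_pos hLL,
      abs_of_nonneg (by linarith : (0 : ℝ) ≤ L), ← hM] at h5
    set E := (L : ℝ) ^ 2 - 1 - (km G v).card with hE
    have hkr : (0 : ℝ) ≤ (km G v).card := Nat.cast_nonneg _
    have h6 : E * L ^ 2 * M ≤ ((L : ℝ) ^ 2 - 1) * (b * (2 * b * M)) := by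
      have := mul_le_mul_of_nonneg_left h3 hLL.le
      calc E * L ^ 2 * M = L * (E * L * M) := by ring
        _ = ((L : ℝ) ^ 2 - 1) * (L * |∑ a ∈ nm G v, z a|) := by rw [h5]; ring
        _ ≤ _ := this
    have h7 : E * L ^ 2 ≤ ((L : ℝ) ^ 2 - 1) * (2 * b ^ 2) := by
      refine le_of_mul_le_mul_right ?_ hMpos
      linarith
    have hb0 : (0 : ℝ) ≤ b := Nat.cast_nonneg _
    have h8 : ((L : ℝ) ^ 2 - 1) * (2 * b ^ 2) ≤ L ^ 2 * (2 * b ^ 2) :=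
      mul_le_mul_of_nonneg_right (by linarith) (by positivity)
    have h9 : E ≤ 2 * b ^ 2 := by
      refine le_of_mul_le_mul_right ?_ (by positivity : (0 : ℝ) < (L : ℝ) ^ 2)
      linarith
    have h10 : (2 : ℝ) * j + 1 ≤ 2 * b ^ 2 := by linarith
    have h11 : 2 * j + 1 ≤ 2 * b ^ 2 := by exact_mod_cast h10
    nlinarith

end Degree

section Phi

variable {V : Type*} [Fintype V] {G : SimpleGraph V} {h : ℕ} {own : V → V} {w : V → ℝ} {b : ℕ}

theorem num_gap {j d β : ℕ} {l : ℝ} (hj1 : 1 ≤ j) (hl : l ^ 2 = d + 1) (hl0 : 0 ≤ l)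
    (h1 : j ^ 2 < d + 1) (h2 : d + 1 < (j + 1) ^ 2) (hβ : 3 * β < j)
    (hg : (l - j) * (j + 1 - l) * (2 * d) ≤ β) : False := by
  have hj1r : (1 : ℝ) ≤ j := by exact_mod_cast hj1
  have h1r : (j : ℝ) ^ 2 + 1 ≤ d + 1 := by exact_mod_cast h1
  have h2r : (d : ℝ) + 1 + 1 ≤ (j + 1) ^ 2 := by exact_mod_cast h2
  have hβr : 3 * (β : ℝ) < j := by exact_mod_cast hβ
  have hlj : (j : ℝ) < l := by nlinarith
  have hlj1 : l < j + 1 := by nlinarith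
  have e : (l - j) * (j + 1 - l) * ((l + j) * (j + 1 + l))
      = ((d : ℝ) + 1 - j ^ 2) * ((j + 1) ^ 2 - (d + 1)) := by
    rw [← hl]; ring
  have e1 : 2 * (j : ℝ) ≤ ((d : ℝ) + 1 - j ^ 2) * ((j + 1) ^ 2 - (d + 1)) := by
    nlinarith
  set P := (l - j) * (j + 1 - l) with hP
  have hP0 : 0 ≤ P := mul_nonneg (by linarith) (by linarith)
  have e2 : (l + j) * (j + 1 + l) ≤ 12 * (j : ℝ) ^ 2 := by
    nlinarith
  have e3 : 2 * (j : ℝ) ≤ P * (12 * (j : ℝ) ^ 2) := by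
    have := mul_le_mul_of_nonneg_left e2 hP0
    linarith
  have e4 : 1 ≤ P * (6 * j) := by nlinarith
  have hβ0 : (0 : ℝ) ≤ β := Nat.cast_nonneg _
  have e5 : P * (2 * (j : ℝ) ^ 2) ≤ β := by
    have : (j : ℝ) ^ 2 ≤ d := by linarith
    have := mul_le_mul_of_nonneg_left this hP0
    linarith
  have e6 : (j : ℝ) ≤ 3 * β := by
    have := mul_le_mul_of_nonneg_left e4 (by linarith : (0 : ℝ) ≤ j)
    linarith
  linarith

theorem Ctx.deg_bound (C : Ctx G h own w) (F : Facts G h) (hh : 2 ≤ h)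
    (hb : ∀ v, (nm G v).card ≤ b) (v : V) :
    dg G v ≤ (3 * (b * (2 * b + 1)) + 2 * b ^ 2 + 2 * b + 3) ^ 2 := by
  set J := 3 * (b * (2 * b + 1)) + 2 * b ^ 2 + 2 * b + 3 with hJ
  by_contra hcon
  push Not at hcon
  obtain ⟨s, -, hsmax⟩ := Finset.exists_max_image Finset.univ (fun v => dg G v)
    ⟨v, Finset.mem_univ v⟩
  have hd : ∀ u, dg G u ≤ dg G s := fun u => hsmax u (Finset.mem_univ u)
  set d := dg G s with hdd
  have hdJ : J ^ 2 < d := hcon.trans_le (hd v)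
  have hJ2 : J ≤ J ^ 2 := by nlinarith
  have hdb : 2 * b + 3 ≤ d := by omega
  have hs : Core G s := by
    by_contra hs
    have := dg_noncore hs
    omega
  have hks : b ≤ (km G s).card := by
    have h1 := dg_eq (G := G) s
    have h2 := hb s
    omega
  obtain ⟨p, dep, R⟩ := exists_rooted C.tree s
  set N1 := Finset.univ.filter (fun u => u ≠ s ∧ p u = s) with hN1
  have mem1 : ∀ u, u ∈ N1 ↔ u ≠ s ∧ p u = s := by intro u; simp [hN1]
  have adj1 : ∀ u, u ∈ N1 ↔ G.Adj s u := by
    intro u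
    rw [mem1]
    constructor
    · rintro ⟨h1, h2⟩
      have := R.par u h1
      rw [h2] at this
      exact this.symm
    · intro hu
      rcases R.adj _ _ hu with h | h
      · exact absurd rfl h.1
      · exact h
  have card1 : N1.card = d := by
    rw [hdd]
    unfold dg
    congr 1
    ext u
    rw [adj1]; simp
  have hchild : ∀ a, ∃ c, a ∈ N1 → c ≠ s ∧ p c = a := by
    intro a
    by_cases ha : a ∈ N1
    · have hsa := (adj1 a).1 ha
      have hnl := C.heavy_noleaf F hs (hb s) hks hsa
      have : ∃ c, G.Adj a c ∧ c ≠ s := by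
        by_contra hcc
        push Not at hcc
        apply hnl
        refine ⟨s, fun u => ⟨hcc u, ?_⟩⟩
        rintro rfl
        exact hsa.symm
      obtain ⟨c, hac, hcs⟩ := this
      refine ⟨c, fun _ => ⟨hcs, ?_⟩⟩
      rcases R.adj _ _ hac with h | h
      · have := ((mem1 a).1 ha).2
        exact absurd (h.2.symm.trans this) hcs
      · exact h.2
    · exact ⟨a, fun h => absurd h ha⟩
  choose c hc using hchild
  set N2 := N1.image c with hN2
  have hs1 : s ∉ N1 := fun h => ((mem1 s).1 h).1 rfl
  have hs2 : s ∉ N2 := by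
    intro h
    obtain ⟨a, ha, hac⟩ := Finset.mem_image.1 h
    exact (hc a ha).1 hac
  have p2 : ∀ u, u ∈ N2 → p u ∈ N1 ∧ c (p u) = u := by
    intro u hu
    obtain ⟨a, ha, hac⟩ := Finset.mem_image.1 hu
    subst hac
    rw [(hc a ha).2]
    exact ⟨ha, rfl⟩
  have h12 : ∀ u, u ∈ N1 → u ∉ N2 := by
    intro u hu hu2
    have := (p2 u hu2).1
    rw [((mem1 u).1 hu).2] at this
    exact hs1 this
  have cinj : Set.InjOn c N1 := by
    intro a ha a' ha' haa
    rw [← (hc a ha).2, ← (hc a' ha').2, haa]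
  have card2 : N2.card = d := by rw [hN2, Finset.card_image_of_injOn cinj, card1]
  obtain ⟨l, hl0, hl⟩ : ∃ l : ℝ, 0 ≤ l ∧ l ^ 2 = d + 1 :=
    ⟨Real.sqrt (d + 1), Real.sqrt_nonneg _, Real.sq_sqrt (by positivity)⟩
  have hlpos : 0 < l := by
    rcases hl0.lt_or_eq with h1 | h1
    · exact h1
    · rw [← h1] at hl
      have : (0 : ℝ) ≤ d := Nat.cast_nonneg _
      norm_num at hl
      linarith
  have hdpos : (0 : ℝ) < d := by
    have : 0 < d := by omega
    exact_mod_cast this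
  set φ : V → ℝ := fun u => if u = s then (d : ℝ) else if u ∈ N1 then l else
    if u ∈ N2 then 1 else 0 with hφ
  have φs : φ s = d := by simp [hφ]
  have φ1 : ∀ u, u ∈ N1 → φ u = l := by
    intro u hu
    simp [hφ, hu, ((mem1 u).1 hu).1]
  have φ2 : ∀ u, u ∈ N2 → φ u = 1 := by
    intro u hu
    have h1 : u ≠ s := by
      rintro rfl
      exact hs2 hu
    have h2 : u ∉ N1 := fun h => h12 u h hu
    simp [hφ, h1, h2, hu]
  have φ0 : ∀ u, u ≠ s → u ∉ N1 → u ∉ N2 → φ u = 0 := by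
    intro u h1 h2 h3
    simp [hφ, h1, h2, h3]
  have supp : ∀ u, φ u ≠ 0 → u = s ∨ u ∈ N1 ∨ u ∈ N2 := by
    intro u hu
    by_contra hcc
    push Not at hcc
    exact hu (φ0 u hcc.1 hcc.2.1 hcc.2.2)
  -- the action on phi
  set er : V → ℝ := fun u => if φ u = 0 then φ (p u) else 0 with her
  have hchild0 : ∀ u, u ≠ s → u ∉ N1 →
      ∑ t ∈ Finset.univ.filter (fun t => t ≠ s ∧ p t = u), φ t = 0 := by
    intro u h1 h2
    refine Finset.sum_eq_zero fun t ht => ?_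
    simp only [Finset.mem_filter, Finset.mem_univ, true_and] at ht
    refine φ0 t ht.1 ?_ ?_
    · intro h3
      have := ((mem1 t).1 h3).2
      exact h1 (ht.2.symm.trans this)
    · intro h3
      have := (p2 t h3).1
      rw [ht.2] at this
      exact h2 this
  have hA : ∀ u, Aop G φ u = l * φ u + er u := by
    intro u
    rw [R.aop]
    by_cases hus : u = s
    · subst hus
      have e1 : ∑ t ∈ N1, φ t = d * l := by
        rw [Finset.sum_congr rfl φ1, Finset.sum_const, nsmul_eq_mul, card1]
      have e2 : er u = 0 := by simp [her, φs, hdpos.ne']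
      rw [e2, φs]
      simp only [ne_eq, not_true, if_false, zero_add, add_zero]
      simp only [ne_eq] at hN1
      rw [← hN1, e1]; ring
    · simp only [ne_eq, hus, not_false_eq_true, if_true]
      by_cases hu1 : u ∈ N1
      · have e2 : er u = 0 := by simp [her, φ1 u hu1, hlpos.ne']
        rw [e2, φ1 u hu1, ((mem1 u).1 hu1).2, φs]
        rw [Finset.sum_eq_single_of_mem (c u)
          (by simp only [Finset.mem_filter, Finset.mem_univ, true_and]; exact hc u hu1)]
        · rw [φ2 (c u) (Finset.mem_image_of_mem c hu1)]
          linear_combination -hl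
        · intro t ht htc
          simp only [Finset.mem_filter, Finset.mem_univ, true_and] at ht
          refine φ0 t ht.1 ?_ ?_
          · intro h3
            exact hus (ht.2.symm.trans ((mem1 t).1 h3).2)
          · intro h3
            have := (p2 t h3).2
            rw [ht.2] at this
            exact htc this.symm
      · have := hchild0 u hus hu1
        simp only [ne_eq] at this
        rw [this, add_zero]
        by_cases hu2 : u ∈ N2
        · have e2 : er u = 0 := by simp [her, φ2 u hu2]
          rw [e2, φ2 u hu2, φ1 _ (p2 u hu2).1]; ring
        · have e0 := φ0 u hus hu1 hu2
          have e2 : er u = φ (p u) := by simp [her, e0]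
          rw [e2, e0]; ring
  have her0 : ∀ u, φ u * er u = 0 := by
    intro u
    simp only [her]
    by_cases h0 : φ u = 0
    · rw [h0, zero_mul]
    · rw [if_neg h0, mul_zero]
  have hS : ∑ u, φ u ^ 2 = 2 * d * (d + 1) := by
    have e1 : ∑ u ∈ insert s (N1 ∪ N2), φ u ^ 2 = ∑ u, φ u ^ 2 := by
      refine Finset.sum_subset (Finset.subset_univ _) fun u _ hu => ?_
      simp only [Finset.mem_insert, Finset.mem_union] at hu
      push Not at hu
      rw [φ0 u hu.1 hu.2.1 hu.2.2]; norm_num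
    rw [← e1, Finset.sum_insert (by simp [hs1, hs2]), Finset.sum_union
      (Finset.disjoint_left.2 h12), φs,
      Finset.sum_congr rfl (fun u hu => by rw [φ1 u hu] : ∀ u ∈ N1, φ u ^ 2 = l ^ 2),
      Finset.sum_congr rfl (fun u hu => by rw [φ2 u hu] : ∀ u ∈ N2, φ u ^ 2 = 1 ^ 2),
      Finset.sum_const, Finset.sum_const, card1, card2, hl, nsmul_eq_mul, nsmul_eq_mul]
    ring
  have hSA : ∑ u, φ u * Aop G φ u = l * ∑ u, φ u ^ 2 := by
    rw [Finset.mul_sum]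
    refine Finset.sum_congr rfl fun u _ => ?_
    rw [hA]
    linear_combination her0 u
  have hSAA : ∑ u, Aop G φ u ^ 2 = l ^ 2 * ∑ u, φ u ^ 2 + ∑ u, er u ^ 2 := by
    rw [Finset.mul_sum, ← Finset.sum_add_distrib]
    refine Finset.sum_congr rfl fun u _ => ?_
    rw [hA]
    linear_combination 2 * l * her0 u
  have hkids : ∀ a, (Finset.univ.filter (fun u => u ≠ s ∧ p u = a)).card ≤ dg G a := by
    intro a
    unfold dg
    refine Finset.card_le_card ?_
    intro u hu
    simp only [Finset.mem_filter, Finset.mem_univ, true_and] at hu ⊢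
    have := R.par u hu.1
    rw [hu.2] at this
    exact this.symm
  have herr : ∑ u, er u ^ 2 ≤ (b * (2 * b + 1) : ℕ) * (d + 1) := by
    have hpt : ∀ u, er u ^ 2 ≤ ∑ a ∈ nm G s, ((if u ≠ s ∧ p u = a then l ^ 2 else 0)
        + (if u ≠ s ∧ p u = c a then 1 else 0)) := by
      intro u
      have hnn : ∀ a ∈ nm G s, 0 ≤ ((if u ≠ s ∧ p u = a then l ^ 2 else 0)
        + (if u ≠ s ∧ p u = c a then 1 else 0)) := by
        intro a _
        have : 0 ≤ l ^ 2 := sq_nonneg l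
        split_ifs <;> linarith
      by_cases he : er u = 0
      · rw [he]
        norm_num
        exact Finset.sum_nonneg hnn
      · have hu0 : φ u = 0 := by
          by_contra hu0
          exact he (by simp [her, hu0])
        have heq : er u = φ (p u) := by simp [her, hu0]
        have hus : u ≠ s := by
          rintro rfl
          rw [φs] at hu0
          exact hdpos.ne' hu0
        have hu1 : u ∉ N1 := fun h => hlpos.ne' ((φ1 u h).symm.trans hu0)
        have hu2 : u ∉ N2 := fun h => one_ne_zero ((φ2 u h).symm.trans hu0)
        have hpu : φ (p u) ≠ 0 := fun h => he (heq.trans h)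
        have hadj := R.par u hus
        -- neighbours of a middle vertex next to the root
        have hmidd : ∀ a, a ∈ N1 → Mid G a → Leaf G (c a) ∧ ∀ t, G.Adj a t → t = c a ∨ t = s := by
          intro a ha hm
          obtain ⟨e, hes, hel, hee⟩ := hm.leaf C.conn C.card hs ((adj1 a).1 ha).symm
          have hca := hc a ha
          have hac : G.Adj a (c a) := by
            have := R.par _ hca.1
            rw [hca.2] at this
            exact this.symm
          have : c a = e := by
            rcases (hee _).1 hac with h | h
            · exact h
            · exact absurd h hca.1
          rw [this]
          exact ⟨hel, fun t ht => (hee t).1 ht⟩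
        rcases supp _ hpu with h | h | h
        · exact absurd ((mem1 u).2 ⟨hus, h⟩) hu1
        · have hnm : ¬ Mid G (p u) := by
            intro hm
            rcases (hmidd _ h hm).2 u hadj.symm with h' | h'
            · exact hu2 (h' ▸ Finset.mem_image_of_mem c h)
            · exact hus h'
          have hmem : p u ∈ nm G s := by
            simp only [nm, Finset.mem_filter, Finset.mem_univ, true_and]
            exact ⟨(adj1 _).1 h, hnm⟩
          refine le_trans ?_ (Finset.single_le_sum hnn hmem)
          rw [heq, φ1 _ h, if_pos ⟨hus, rfl⟩]
          split_ifs <;> linarith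
        · obtain ⟨g1, g2⟩ := p2 _ h
          have hnm : ¬ Mid G (p (p u)) := by
            intro hm
            have hlf := (hmidd _ g1 hm).1
            rw [g2] at hlf
            have hps : p u ≠ s := by
              intro h'
              exact hs2 (h' ▸ h)
            have := hlf.unique hadj.symm (R.par _ hps)
            have d1 := R.dpt u hus
            have d2 := R.dpt _ hps
            rw [← this] at d2
            omega
          have hmem : p (p u) ∈ nm G s := by
            simp only [nm, Finset.mem_filter, Finset.mem_univ, true_and]
            exact ⟨(adj1 _).1 g1, hnm⟩
          refine le_trans ?_ (Finset.single_le_sum hnn hmem)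
          rw [heq, φ2 _ h, g2, if_pos (⟨hus, rfl⟩ : u ≠ s ∧ p u = p u)]
          have : 0 ≤ l ^ 2 := sq_nonneg l
          split_ifs <;> linarith
    refine (Finset.sum_le_sum fun u _ => hpt u).trans ?_
    rw [Finset.sum_comm]
    have hone : ∀ a ∈ nm G s, ∑ u, ((if u ≠ s ∧ p u = a then l ^ 2 else 0)
        + (if u ≠ s ∧ p u = c a then (1 : ℝ) else 0)) ≤ (2 * b + 1) * (d + 1) := by
      intro a ha
      have hlt := (C.heavy_light F hb hs hks ha).2
      rw [Finset.sum_add_distrib, ← Finset.sum_filter, ← Finset.sum_filter, Finset.sum_const,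
        Finset.sum_const, nsmul_eq_mul, nsmul_eq_mul, hl, mul_one]
      have k1 := hkids a
      have k2 := (hkids (c a)).trans (hd (c a))
      have k3 : dg G a ≤ 2 * b := by
        rw [dg_eq]
        have := hb a
        omega
      have k4 : ((Finset.univ.filter (fun u => u ≠ s ∧ p u = a)).card : ℝ) ≤ 2 * b := by
        exact_mod_cast k1.trans k3
      have k5 : ((Finset.univ.filter (fun u => u ≠ s ∧ p u = c a)).card : ℝ) ≤ d := by
        exact_mod_cast k2
      have k6 := mul_le_mul_of_nonneg_right k4 (by linarith : (0 : ℝ) ≤ d + 1)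
      linarith
    refine (Finset.sum_le_card_nsmul _ _ _ hone).trans ?_
    rw [nsmul_eq_mul]
    have : ((nm G s).card : ℝ) ≤ b := by exact_mod_cast hb s
    have k7 := mul_le_mul_of_nonneg_right this
      (by positivity : (0 : ℝ) ≤ (2 * b + 1) * ((d : ℝ) + 1))
    push_cast
    linarith
  obtain ⟨j, hjle, hjlt⟩ : ∃ j : ℕ, j ^ 2 ≤ d + 1 ∧ d + 1 < (j + 1) ^ 2 :=
    ⟨Nat.sqrt (d + 1), Nat.sqrt_le' _, Nat.lt_succ_sqrt' _⟩
  have hJj : J ≤ j := by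
    by_contra hlt
    push Not at hlt
    have : (j + 1) ^ 2 ≤ J ^ 2 := Nat.pow_le_pow_left hlt 2
    omega
  have hj1 : 1 ≤ j := by omega
  have hjsq : j ^ 2 = d + 1 := by
    by_contra hne
    have h1 : j ^ 2 < d + 1 := lt_of_le_of_ne hjle hne
    have hg := F.gap φ j
    rw [hSAA, hSA, hS] at hg
    push_cast at hg
    refine num_gap hj1 hl hl0 h1 hjlt (β := b * (2 * b + 1)) (by omega) ?_
    refine le_of_mul_le_mul_right ?_ (by linarith : (0 : ℝ) < d + 1)
    nlinarith
  have hlj : l = j := by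
    have : l ^ 2 = (j : ℝ) ^ 2 := by
      rw [hl]; exact_mod_cast hjsq.symm
    exact (pow_left_inj₀ hl0 (Nat.cast_nonneg _) two_ne_zero).1 this
  rcases F.top (j : ℤ) with ⟨L, hL, z, hz0, hz⟩ | htop
  · obtain ⟨L', rfl⟩ : ∃ L' : ℕ, L = L' := ⟨L.toNat, by omega⟩
    refine C.no_top F hb hd hjsq (by omega) (by omega : j + 1 ≤ L') z hz0 ?_
    intro u
    have := hz u
    push_cast at this
    exact this
  · have hAj := htop φ (by rw [hSA, hlj]; push_cast; rfl)
    have her00 : ∀ u, er u = 0 := by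
      intro u
      have h1 := hAj u
      rw [hA, hlj] at h1
      push_cast at h1
      linarith
    have hall : ∀ n u, dep u = n → φ u ≠ 0 := by
      intro n
      induction n with
      | zero =>
        intro u hu hu0
        have hus : u ≠ s := by
          rintro rfl
          rw [φs] at hu0
          exact hdpos.ne' hu0
        have := R.dpt u hus
        omega
      | succ n ih =>
        intro u hu hu0
        have hus : u ≠ s := by
          rintro rfl
          rw [φs] at hu0
          exact hdpos.ne' hu0
        have h1 := R.dpt u hus
        have h2 := ih (p u) (by omega)
        have h3 := her00 u
        simp only [her, hu0, if_true] at h3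
        exact h2 h3
    have hcov : ∀ u, u = s ∨ u ∈ N1 ∨ u ∈ N2 := fun u => supp u (hall _ u rfl)
    obtain ⟨z, hz0, hz, hzs⟩ := F.two hh s
    apply hz0
    have z1 : ∀ a, a ∈ N1 → z a = 0 := by
      intro a ha
      have hca := hc a ha
      have hmem : c a ∈ N2 := Finset.mem_image_of_mem c ha
      have h1 := hz (c a)
      rw [R.aop, if_pos hca.1, hca.2, Finset.sum_eq_zero, add_zero] at h1
      · exact h1
      · intro t ht
        exfalso
        simp only [Finset.mem_filter, Finset.mem_univ, true_and] at ht
        rcases hcov t with h | h | h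
        · exact ht.1 h
        · exact hca.1 (ht.2.symm.trans ((mem1 t).1 h).2)
        · have := (p2 t h).1
          rw [ht.2] at this
          exact h12 _ this hmem
    have z2 : ∀ a, a ∈ N1 → z (c a) = 0 := by
      intro a ha
      have hca := hc a ha
      have h1 := hz a
      have ha' := (mem1 a).1 ha
      rw [R.aop, if_pos ha'.1, ha'.2, hzs, zero_add, Finset.sum_eq_single_of_mem (c a)
        (by simp only [Finset.mem_filter, Finset.mem_univ, true_and]; exact hca)] at h1
      · exact h1
      · intro t ht htc
        exfalso
        simp only [Finset.mem_filter, Finset.mem_univ, true_and] at ht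
        rcases hcov t with h | h | h
        · exact ht.1 h
        · exact ha'.1 (ht.2.symm.trans ((mem1 t).1 h).2)
        · have := (p2 t h).2
          rw [ht.2] at this
          exact htc this.symm
    funext u
    rcases hcov u with h | h | h
    · rw [h]; exact hzs
    · exact z1 u h
    · have := p2 u h
      rw [← this.2]
      exact z2 _ this.1

end Phi

section Final

variable {V : Type*} [Fintype V] {G : SimpleGraph V} {h : ℕ} {own : V → V} {w : V → ℝ}

theorem Ctx.card_bound (C : Ctx G h own w) {D : ℕ} (hD : ∀ v, dg G v ≤ D) :
    Fintype.card V ≤ (1291 * h + 127) * (1 + D + D * D) := by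
  have hsub : (Finset.univ : Finset V) ⊆ (Finset.univ.filter (fun v => Core G v)).biUnion
      (fun v => ({v} ∪ Finset.univ.filter (fun u => G.Adj v u))
        ∪ (Finset.univ.filter (fun a => G.Adj v a)).biUnion
          (fun a => Finset.univ.filter (fun u => G.Adj a u))) := by
    intro u _
    simp only [Finset.mem_biUnion, Finset.mem_filter, Finset.mem_univ, true_and,
      Finset.mem_union, Finset.mem_singleton]
    refine ⟨own u, C.own.core u, ?_⟩
    rcases C.own.ex u with h | h | ⟨a, h1, h2⟩
    · exact Or.inl (Or.inl h.symm)
    · exact Or.inl (Or.inr h.symm)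
    · exact Or.inr ⟨a, h2.symm, h1.symm⟩
  have h1 := Finset.card_le_card hsub
  rw [Finset.card_univ] at h1
  refine h1.trans (le_trans (Finset.card_biUnion_le_card_mul _ _ (1 + D + D * D) ?_)
    (Nat.mul_le_mul_right _ C.core_card))
  intro v _
  refine (Finset.card_union_le _ _).trans (Nat.add_le_add ?_ ?_)
  · refine (Finset.card_union_le _ _).trans (Nat.add_le_add (by simp) (hD v))
  · exact (Finset.card_biUnion_le_card_mul _ _ D fun a _ => hD a).trans
      (Nat.mul_le_mul_right _ (hD v))

/-- The final bound. -/
def Dbd (h : ℕ) : ℕ :=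
  (3 * ((1293 * h + 128) * (2 * (1293 * h + 128) + 1)) + 2 * (1293 * h + 128) ^ 2
    + 2 * (1293 * h + 128) + 3) ^ 2

theorem card_final (hT : G.IsTree) (F : Facts G h) (hh : 2 ≤ h) :
    Fintype.card V ≤ 4 + (1291 * h + 127) * (1 + Dbd h + Dbd h * Dbd h) := by
  rcases le_or_gt (Fintype.card V) 4 with h4 | h4
  · omega
  · obtain ⟨own, hown⟩ := exists_own hT.connected (by omega : 5 ≤ Fintype.card V)
    obtain ⟨w, w1, w2, w3, w4⟩ := F.mass
    have C : Ctx G h own w := ⟨hT, by omega, hown, w1, w2, w3, w4⟩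
    have := C.card_bound (D := Dbd h) (fun v => C.deg_bound F hh C.nm_card v)
    omega

end Final

end IT

theorem stmt16 (h : ℕ) (hh : 2 ≤ h) :
    {n : ℕ | ∃ G : SimpleGraph (Fin n), G.IsTree ∧ GraphIntegral G ∧ gNullity G = h}.Finite := by
  refine Set.Finite.subset (Set.finite_Iic
    (4 + (1291 * h + 127) * (1 + IT.Dbd h + IT.Dbd h * IT.Dbd h))) ?_
  rintro n ⟨G, hT, hI, hN⟩
  obtain ⟨S⟩ := IT.exists_spec G h hI hN
  have := IT.card_final hT S.facts hh
  rw [Fintype.card_fin] at this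
  exact this
end

section
/- Let T be a tree whose adjacency matrix has nullity 1 and which has no eigenvalue in (0, 1) ∪ (1, 2). Then either T is the one-vertex tree, or T = S(p) for some p ≥ 1, where S(p) is the spider obtained from the star K_{1,p+2} by subdividing every edge once. -/
open scoped Classical

/-- The spider `S(p)`: `p + 2` paths of length 2 glued at a common endpoint
(the star `K_{1,p+2}` with every edge subdivided once). `Sum.inl ()` is the center,
`Sum.inr (i, false)` is the middle of leg `i`, `Sum.inr (i, true)` its leaf. -/
def spider (p : ℕ) : SimpleGraph (Unit ⊕ (Fin (p + 2) × Bool)) :=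
  SimpleGraph.fromRel (fun x y =>
    match x, y with
    | Sum.inl _, Sum.inr q => q.2 = false
    | Sum.inr q, Sum.inr q' => q.1 = q'.1 ∧ q.2 = false ∧ q'.2 = true
    | _, _ => False)

open Matrix in
/-- Eigenvectors give roots of the characteristic polynomial. -/
theorem aux_mem_roots {V : Type*} [Fintype V] [DecidableEq V] (A : Matrix V V ℝ) (μ : ℝ)
    (f : V → ℝ) (hf : f ≠ 0) (h : A *ᵥ f = μ • f) : μ ∈ A.charpoly.roots := by
  rw [Polynomial.mem_roots A.charpoly_monic.ne_zero, Polynomial.IsRoot.def, Matrix.eval_charpoly,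
    ← Matrix.exists_mulVec_eq_zero_iff]
  refine ⟨f, hf, ?_⟩
  rw [Matrix.sub_mulVec, h]
  ext i
  simp [Matrix.scalar_apply]

open Matrix in
theorem aux_spectral {V : Type*} [Fintype V] [DecidableEq V] (A : Matrix V V ℝ)
    (hA : A.IsHermitian)
    (hev : ∀ (μ : ℝ) (f : V → ℝ), f ≠ 0 → A *ᵥ f = μ • f → μ = 0 ∨ 1 ≤ μ ^ 2)
    (f : V → ℝ) (hf : ∀ g, A *ᵥ g = 0 → g ⬝ᵥ f = 0) :
    f ⬝ᵥ f ≤ (A *ᵥ f) ⬝ᵥ (A *ᵥ f) := by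
  have key : ∀ g : V → ℝ, g ⬝ᵥ g =
      ∑ i, ((hA.eigenvectorBasis i).ofLp ⬝ᵥ g) ^ 2 := by
    intro g
    have := hA.eigenvectorBasis.sum_inner_mul_inner (WithLp.toLp 2 g) (WithLp.toLp 2 g)
    simp only [EuclideanSpace.inner_eq_star_dotProduct, star_trivial] at this
    rw [← this]
    refine Finset.sum_congr rfl fun i _ => ?_
    rw [dotProduct_comm g, sq]
  rw [key f, key (A *ᵥ f)]
  refine Finset.sum_le_sum fun i _ => ?_
  have h1 := hA.mulVec_eigenvectorBasis i
  set e : V → ℝ := (hA.eigenvectorBasis i).ofLp with he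
  have he0 : e ≠ 0 := by
    intro h
    have := hA.eigenvectorBasis.orthonormal.ne_zero i
    apply this
    ext j
    exact congrFun h j
  have h2 : e ⬝ᵥ (A *ᵥ f) = hA.eigenvalues i * (e ⬝ᵥ f) := by
    rw [dotProduct_mulVec, ← mulVec_transpose]
    have : Aᵀ = A := by simpa [Matrix.IsHermitian] using hA
    rw [this, h1, smul_dotProduct]
    rfl
  rw [h2, mul_pow]
  rcases hev _ e he0 h1 with h | h
  · rw [h, zero_smul] at h1
    rw [hf e h1]; simp
  · nlinarith [sq_nonneg (e ⬝ᵥ f)]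

theorem aux_conn {V : Type*} {T : SimpleGraph V} (hT : T.Connected) (P : V → Prop)
    (h : ∀ a b, T.Adj a b → P a → P b) (v : V) (hv : P v) (w : V) : P w := by
  obtain ⟨p⟩ := hT.preconnected v w
  induction p with
  | nil => exact hv
  | cons hadj _ ih => exact ih (h _ _ hadj hv)

open Matrix in
/-- Norm of the image of a two-vertex vector. -/
theorem aux_norm {V : Type*} [Fintype V] [DecidableEq V] (T : SimpleGraph V)
    [DecidableRel T.Adj] (v y u : V) (s : ℝ) (hv : ∀ w, T.Adj v w ↔ w = y) (hu : T.Adj u y) :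
    (T.adjMatrix ℝ *ᵥ (Pi.single u 1 + s • Pi.single v 1)) ⬝ᵥ
      (T.adjMatrix ℝ *ᵥ (Pi.single u 1 + s • Pi.single v 1)) = T.degree u + 2 * s + s ^ 2 := by
  have h1 : ∀ w, (T.adjMatrix ℝ *ᵥ (Pi.single u 1 + s • Pi.single v 1)) w =
      (if T.Adj u w then 1 else 0) + s * (if w = y then 1 else 0) := by
    intro w
    rw [mulVec_add, mulVec_smul]
    simp [SimpleGraph.adjMatrix_apply, T.adj_comm w, hv]
  simp only [dotProduct, h1]
  have h2 : ∀ w, ((if T.Adj u w then (1:ℝ) else 0) + s * (if w = y then 1 else 0)) *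
     ((if T.Adj u w then (1:ℝ) else 0) + s * (if w = y then 1 else 0)) =
     (if T.Adj u w then (1:ℝ) else 0) + if w = y then 2 * s + s ^ 2 else 0 := by
    intro w
    by_cases hw : w = y
    · subst hw; simp [hu]; ring
    · simp [hw]
  simp only [h2, Finset.sum_add_distrib]
  simp [SimpleGraph.degree, SimpleGraph.neighborFinset_eq_filter]
  ring

open Matrix in
/-- Vertices in the class where the kernel vanishes have degree two. -/
theorem aux_deg {V : Type*} [Fintype V] [DecidableEq V] (T : SimpleGraph V)
    [DecidableRel T.Adj] [Nontrivial V] (hT : T.Connected) (c : V → Bool)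
    (hc : ∀ a b, T.Adj a b → c a ≠ c b) (z : V → ℝ) (hz : z ≠ 0)
    (hAz : T.adjMatrix ℝ *ᵥ z = 0) (hzc : ∀ v, c v = false → z v = 0)
    (key : ∀ f : V → ℝ, z ⬝ᵥ f = 0 →
      f ⬝ᵥ f ≤ (T.adjMatrix ℝ *ᵥ f) ⬝ᵥ (T.adjMatrix ℝ *ᵥ f))
    (y : V) (hy : c y = false) : 2 ≤ T.degree y := by
  by_contra hlt
  have hpos := hT.preconnected.degree_pos_of_nontrivial y
  have h1 : T.degree y = 1 := by omega
  rw [SimpleGraph.degree_eq_one_iff_existsUnique_adj] at h1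
  obtain ⟨x, hx, hxu⟩ := h1
  have hN : ∀ w, T.Adj y w ↔ w = x := fun w => ⟨hxu w, fun h => h ▸ hx⟩
  have hzx : z x = 0 := by
    have := congrFun hAz y
    rw [SimpleGraph.adjMatrix_mulVec_apply] at this
    have h3 : T.neighborFinset y = {x} := by ext w; simp [hN]
    simpa [h3] using this
  by_cases hex : ∃ y', T.Adj x y' ∧ y' ≠ y
  · obtain ⟨y', hy', hne⟩ := hex
    have hcy' : c y' = false := by
      have := hc _ _ hx; have := hc _ _ hy'; grind
    have h4 := key (Pi.single y' 1 + (-(T.degree y' : ℝ)) • Pi.single y 1) (by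
      simp [hzc _ hy, hzc _ hcy'])
    rw [aux_norm T y x y' _ hN hy'.symm] at h4
    simp [hne, hne.symm] at h4
    nlinarith
  · push Not at hex
    apply hz
    funext w
    have := aux_conn hT (fun w => w = x ∨ w = y) (by
      rintro a b hab (rfl | rfl)
      · exact Or.inr (hex b hab)
      · exact Or.inl (hxu b hab)) y (Or.inr rfl) w
    rcases this with rfl | rfl
    · exact hzx
    · exact hzc _ hy

open Matrix in
theorem aux_card {V : Type*} [Fintype V] [DecidableEq V] (T : SimpleGraph V)
    [DecidableRel T.Adj] (c : V → Bool)
    (hc : ∀ a b, T.Adj a b → c a ≠ c b) (z : V → ℝ) (hz : z ≠ 0)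
    (huniq : ∀ f, T.adjMatrix ℝ *ᵥ f = 0 → ∃ a : ℝ, f = a • z) :
    (Finset.univ.filter fun v => c v = true).card ≤
      (Finset.univ.filter fun v => c v = false).card + 1 := by
  let E : ({v // c v = true} → ℝ) →ₗ[ℝ] (V → ℝ) :=
    { toFun := fun f v => if h : c v = true then f ⟨v, h⟩ else 0
      map_add' := by intro f g; ext v; by_cases h : c v = true <;> simp [h]
      map_smul' := by intro a f; ext v; by_cases h : c v = true <;> simp [h] }
  let F : ({v // c v = true} → ℝ) →ₗ[ℝ] (({v // c v = false} → ℝ) × ℝ) :=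
    { toFun := fun f => (fun v => (T.adjMatrix ℝ *ᵥ E f) v, z ⬝ᵥ E f)
      map_add' := by intro f g; ext <;> simp [Finset.sum_add_distrib, dotProduct_add]
      map_smul' := by intro a f; ext <;> simp [Finset.mul_sum, dotProduct_smul] }
  have hF : Function.Injective F := by
    rw [injective_iff_map_eq_zero]
    intro f hf
    have h1 : ∀ v : {v // c v = false}, (T.adjMatrix ℝ *ᵥ E f) v = 0 :=
      fun v => congrFun (congrArg Prod.fst hf) v
    have h2 : z ⬝ᵥ E f = 0 := congrArg Prod.snd hf
    have h3 : T.adjMatrix ℝ *ᵥ E f = 0 := by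
      funext v
      by_cases hv : c v = true
      · rw [SimpleGraph.adjMatrix_mulVec_apply]
        refine Finset.sum_eq_zero fun w hw => ?_
        have : T.Adj v w := by simpa using hw
        have := hc _ _ this
        have hw' : ¬ c w = true := by grind
        exact dif_neg hw'
      · exact h1 ⟨v, by simpa using hv⟩
    obtain ⟨a, ha⟩ := huniq _ h3
    have h4 : E f = 0 := by
      rw [ha, dotProduct_smul, smul_eq_mul, mul_eq_zero] at h2
      rcases h2 with h2 | h2
      · rw [ha, h2, zero_smul]
      · exact absurd (dotProduct_self_eq_zero.1 h2) hz
    funext v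
    have := congrFun h4 v.1
    have h5 : E f v.1 = f v := by
      show (if h : c v.1 = true then f ⟨v.1, h⟩ else 0) = _
      rw [dif_pos v.2]
    rw [← h5, this]; rfl
  have := LinearMap.finrank_le_finrank_of_injective hF
  simpa [Fintype.card_subtype] using this

open Matrix in
/-- Every vertex of the small class is adjacent to one centre. -/
theorem aux_struct {V : Type*} [Fintype V] [DecidableEq V] (T : SimpleGraph V)
    [DecidableRel T.Adj] [Nontrivial V] (hT : T.IsTree) (c : V → Bool)
    (hc : ∀ a b, T.Adj a b → c a ≠ c b) (z : V → ℝ) (hz : z ≠ 0)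
    (hAz : T.adjMatrix ℝ *ᵥ z = 0) (hzc : ∀ v, c v = false → z v = 0)
    (huniq : ∀ f, T.adjMatrix ℝ *ᵥ f = 0 → ∃ a : ℝ, f = a • z)
    (key : ∀ f : V → ℝ, z ⬝ᵥ f = 0 →
      f ⬝ᵥ f ≤ (T.adjMatrix ℝ *ᵥ f) ⬝ᵥ (T.adjMatrix ℝ *ᵥ f)) :
    ∃ u, c u = true ∧ (∀ y, c y = false → T.Adj u y) ∧ (∀ y, c y = false → T.degree y = 2) ∧
      (Finset.univ.filter fun v => c v = true).card =
      (Finset.univ.filter fun v => c v = false).card + 1 := by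
  have hdeg := aux_deg T hT.connected c hc z hz hAz hzc key
  have hle := aux_card T c hc z hz huniq
  set X := Finset.univ.filter fun v => c v = true with hX
  set Y := Finset.univ.filter fun v => c v = false with hY
  have hbip : T.IsBipartiteWith (X : Set V) (Y : Set V) := by
    constructor
    · rw [Finset.disjoint_coe, Finset.disjoint_left]; intro a; simp [hX, hY]
    · intro a b hab
      have := hc _ _ hab
      simp only [hX, hY, Finset.coe_filter, Finset.mem_univ, true_and, Set.mem_ofPred_eq]
      grind
  have hsum := SimpleGraph.isBipartiteWith_sum_degrees_eq_card_edges' hbip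
  have hedge := hT.card_edgeFinset
  have hcardV : X.card + Y.card = Fintype.card V := by
    have := Finset.card_filter_add_card_filter_not (s := (Finset.univ : Finset V)) (fun v => c v = true)
    simpa [hX, hY] using this
  have h2Y : Y.card * 2 ≤ ∑ v ∈ Y, T.degree v := by
    rw [← smul_eq_mul]
    exact Finset.card_nsmul_le_sum _ _ _ fun v hv => hdeg v (by simpa [hY] using hv)
  have hXY : X.card = Y.card + 1 := by omega
  have hdeg2 : ∀ y, c y = false → T.degree y = 2 := by
    have h : ∑ v ∈ Y, 2 = ∑ v ∈ Y, T.degree v := by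
      rw [Finset.sum_const, smul_eq_mul]; omega
    have := (Finset.sum_eq_sum_iff_of_le
      (fun v hv => hdeg v (by simpa [hY] using hv))).1 h
    intro y hy
    exact (this y (by simpa [hY] using hy)).symm
  -- neighbours of small-class vertices have opposite values
  have hopp : ∀ y a b, c y = false → T.Adj y a → T.Adj y b → a ≠ b → z a + z b = 0 := by
    intro y a b hy ha hb hab
    have h1 : T.neighborFinset y = {a, b} := by
      symm
      apply Finset.eq_of_subset_of_card_le
      · intro w; simp; rintro (rfl | rfl) <;> assumption
      · rw [T.card_neighborFinset_eq_degree, hdeg2 y hy, Finset.card_pair hab]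
    have := congrFun hAz y
    rw [SimpleGraph.adjMatrix_mulVec_apply, h1, Finset.sum_pair hab] at this
    exact this
  obtain ⟨v, hv⟩ := hT.exists_vert_degree_one_of_nontrivial
  have hcv : c v = true := by
    by_contra h
    have := hdeg2 v (by simpa using h)
    omega
  have hsq : ∀ x, c x = true → z x ^ 2 = z v ^ 2 := by
    have := aux_conn hT.connected (fun w => (c w = true → z w ^ 2 = z v ^ 2) ∧
      (c w = false → ∀ x, T.Adj w x → z x ^ 2 = z v ^ 2)) (by
        rintro a b hab ⟨h1, h2⟩
        have hcab := hc _ _ hab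
        constructor
        · intro hb
          exact h2 (by grind) b hab
        · intro hb x hbx
          have ha := h1 (by grind)
          by_cases hxa : x = a
          · rw [hxa]; exact ha
          · have := hopp b x a hb hbx hab.symm hxa
            have : z x = - z a := by linarith
            rw [this, neg_sq, ha]) v ⟨fun _ => rfl, fun h => by simp [hcv] at h⟩
    exact fun x hx => (this x).1 hx
  have hzv : z v ≠ 0 := by
    intro h
    apply hz
    funext w
    by_cases hw : c w = true
    · have := hsq w hw
      rw [h] at this
      simpa using this
    · exact hzc w (by simpa using hw)
  have hleaf := hv
  rw [SimpleGraph.degree_eq_one_iff_existsUnique_adj] at hv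
  obtain ⟨y, hy, hyu⟩ := hv
  have hN : ∀ w, T.Adj v w ↔ w = y := fun w => ⟨hyu w, fun h => h ▸ hy⟩
  have hcy : c y = false := by have := hc _ _ hy; grind
  obtain ⟨u, hu, huv⟩ : ∃ u, T.Adj y u ∧ u ≠ v := by
    have : 1 < (T.neighborFinset y).card := by
      rw [T.card_neighborFinset_eq_degree, hdeg2 y hcy]; norm_num
    obtain ⟨u, hu, huv⟩ := Finset.exists_mem_ne this v
    exact ⟨u, by simpa using hu, huv⟩
  have hcu : c u = true := by have := hc _ _ hu; grind
  have hzu : z u = - z v := by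
    have := hopp y u v hcy hu hy.symm huv
    linarith
  -- normalised kernel vector
  set n : ℝ := (X.card : ℝ) with hn
  have hzz : z ⬝ᵥ z = n * z v ^ 2 := by
    have : ∀ w, z w * z w = if c w = true then z v ^ 2 else 0 := by
      intro w
      by_cases hw : c w = true
      · rw [if_pos hw, ← hsq w hw, sq]
      · rw [if_neg hw, hzc w (by simpa using hw), mul_zero]
    simp only [dotProduct, this]
    rw [← Finset.sum_filter, Finset.sum_const, nsmul_eq_mul]
  have hmain := key ((z v)⁻¹ • z + (Pi.single u 1 + (1 - n) • Pi.single v 1)) (by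
    simp [dotProduct_add, hzz, hzu]
    field_simp
    ring)
  rw [mulVec_add, mulVec_smul, hAz, smul_zero, zero_add, aux_norm T v y u _ hN hu.symm] at hmain
  simp [dotProduct_add, add_dotProduct, hzz, hzu, huv, huv.symm] at hmain
  have hd : n - 1 ≤ T.degree u := by
    field_simp at hmain
    nlinarith
  have hd' : Y.card ≤ T.degree u := by
    have : (Y.card : ℝ) ≤ T.degree u := by
      rw [hn, hXY] at hd; push_cast at hd; linarith
    exact_mod_cast this
  have hNu : T.neighborFinset u = Y := by
    apply Finset.eq_of_subset_of_card_le
    · intro w hw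
      have : T.Adj u w := by simpa using hw
      have := hc _ _ this
      simp only [hY, Finset.mem_filter, Finset.mem_univ, true_and]
      grind
    · rwa [T.card_neighborFinset_eq_degree]
  refine ⟨u, hcu, ?_, hdeg2, hXY⟩
  intro w hw
  have : w ∈ T.neighborFinset u := by rw [hNu]; simpa [hY] using hw
  simpa using this

open Matrix in
theorem aux_iso {V : Type*} [Fintype V] [DecidableEq V] (T : SimpleGraph V)
    [DecidableRel T.Adj] [Nontrivial V] (hT : T.Connected) (c : V → Bool)
    (hc : ∀ a b, T.Adj a b → c a ≠ c b)
    (hev : ∀ (μ : ℝ) (f : V → ℝ), f ≠ 0 → T.adjMatrix ℝ *ᵥ f = μ • f → ¬ (1 < μ ∧ μ < 2))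
    (u : V) (hcu : c u = true) (hu : ∀ y, c y = false → T.Adj u y)
    (hdeg2 : ∀ y, c y = false → T.degree y = 2)
    (hcard : (Finset.univ.filter fun v => c v = true).card =
      (Finset.univ.filter fun v => c v = false).card + 1) :
    ∃ p : ℕ, 1 ≤ p ∧ Nonempty (T ≃g spider p) := by
  have hg : ∀ y : {v // c v = false}, ∃ x, x ≠ u ∧ ∀ w, T.Adj y w ↔ (w = u ∨ w = x) := by
    rintro ⟨y, hy⟩
    have h1 : 1 < (T.neighborFinset y).card := by
      rw [T.card_neighborFinset_eq_degree, hdeg2 y hy]; norm_num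
    obtain ⟨x, hx, hxu⟩ := Finset.exists_mem_ne h1 u
    refine ⟨x, hxu, fun w => ?_⟩
    have h2 : {u, x} = T.neighborFinset y := by
      apply Finset.eq_of_subset_of_card_le
      · intro w; simp only [Finset.mem_insert, Finset.mem_singleton]
        rintro (rfl | rfl)
        · simpa using (hu y hy).symm
        · exact hx
      · rw [T.card_neighborFinset_eq_degree, hdeg2 y hy, Finset.card_pair hxu.symm]
    rw [← SimpleGraph.mem_neighborFinset, ← h2]; simp
  choose g hgu hg using hg
  have hcg : ∀ y, c (g y) = true := by
    intro y
    have := hc _ _ ((hg y (g y)).2 (Or.inr rfl))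
    have := y.2
    grind
  have hcx : ∀ x, x ≠ u → c x = true → ∃ y, g y = x := by
    intro x hxu hx
    obtain ⟨y, hy⟩ := hT.preconnected.exists_adj_of_nontrivial x
    have hcy : c y = false := by have := hc _ _ hy; grind
    rcases (hg ⟨y, hcy⟩ x).1 hy.symm with h | h
    · exact absurd h hxu
    · exact ⟨⟨y, hcy⟩, h.symm⟩
  let G : {v // c v = false} → {v // c v = true ∧ v ≠ u} := fun y => ⟨g y, hcg y, hgu y⟩
  have hGs : Function.Surjective G := by
    rintro ⟨x, hx, hxu⟩
    obtain ⟨y, hy⟩ := hcx x hxu hx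
    exact ⟨y, Subtype.ext hy⟩
  have hGc : Fintype.card {v // c v = false} = Fintype.card {v // c v = true ∧ v ≠ u} := by
    rw [Fintype.card_subtype, Fintype.card_subtype, Finset.filter_and, Finset.filter_ne',
      ← Finset.erase_eq_of_notMem (Finset.notMem_erase u Finset.univ)]
    have : (Finset.univ.filter fun v => c v = true) ∩ (Finset.univ.erase u).erase u =
        (Finset.univ.filter fun v => c v = true).erase u := by
      ext w; simp; tauto
    rw [this, Finset.card_erase_of_mem (by simpa using hcu), hcard]; rfl
  have hGb : Function.Bijective G :=
    (Fintype.bijective_iff_surjective_and_card G).2 ⟨hGs, hGc⟩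
  have hginj : ∀ y y', g y = g y' → y = y' := fun y y' h => hGb.1 (Subtype.ext h)
  set m := Fintype.card {v // c v = false} with hm
  have hNu : ∀ w, T.Adj u w ↔ c w = false := by
    intro w
    exact ⟨fun h => by have := hc _ _ h; grind, hu w⟩
  have hm1 : 1 ≤ m := by
    obtain ⟨y, hy⟩ := hT.preconnected.exists_adj_of_nontrivial u
    exact Fintype.card_pos_iff.2 ⟨⟨y, (hNu y).1 hy⟩⟩
  have hm3 : 3 ≤ m := by
    by_contra hlt
    have hmle : (m : ℝ) ≤ 2 := by
      have : m ≤ 2 := by omega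
      exact_mod_cast this
    have hmge : (1 : ℝ) ≤ m := by exact_mod_cast hm1
    refine hev (Real.sqrt (m + 1))
      (fun v => if v = u then (m : ℝ) else if c v = false then Real.sqrt (m + 1) else 1) ?_ ?_ ?_
    · intro h
      have := congrFun h u
      simp at this
      omega
    · funext v
      have hs : Real.sqrt (m + 1) * Real.sqrt (m + 1) = m + 1 :=
        Real.mul_self_sqrt (by linarith)
      rw [SimpleGraph.adjMatrix_mulVec_apply, Pi.smul_apply, smul_eq_mul]
      by_cases hvu : v = u
      · subst hvu
        rw [Finset.sum_congr rfl (g := fun _ => Real.sqrt (m + 1))]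
        · have : (T.neighborFinset v).card = m := by
            rw [hm, Fintype.card_subtype]
            congr 1
            ext w; simp [hNu]
          rw [Finset.sum_const, this, nsmul_eq_mul, if_pos rfl, mul_comm]
        · intro w hw
          have hw' : T.Adj v w := by simpa using hw
          rw [if_neg hw'.ne', if_pos ((hNu w).1 hw')]
      · by_cases hcv : c v = false
        · have : T.neighborFinset v = {u, g ⟨v, hcv⟩} := by
            ext w; simp [hg ⟨v, hcv⟩]
          rw [this, Finset.sum_pair (hgu _).symm]
          simp [hvu, hcv, hcg, hgu, hs]
        · obtain ⟨y, rfl⟩ := hcx v hvu (by simpa using hcv)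
          have : T.neighborFinset (g y) = {y.1} := by
            ext w
            rw [SimpleGraph.mem_neighborFinset, Finset.mem_singleton]
            constructor
            · intro h
              have hcw : c w = false := by have := hc _ _ h; have := hcg y; grind
              rcases (hg ⟨w, hcw⟩ (g y)).1 h.symm with h' | h'
              · exact absurd h' hvu
              · have := hginj _ _ h'
                rw [this]
            · rintro rfl
              exact ((hg y _).2 (Or.inr rfl)).symm
          rw [this, Finset.sum_singleton]
          have hyu : y.1 ≠ u := by
            intro h; have := y.2; rw [h, hcu] at this; simp at this
          simp [hyu, y.2, hgu, hcg]
    · constructor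
      · rw [Real.lt_sqrt] <;> linarith
      · rw [Real.sqrt_lt'] <;> linarith
  obtain ⟨p, hp⟩ : ∃ p, m = p + 2 := ⟨m - 2, by omega⟩
  refine ⟨p, by omega, ?_⟩
  let e : Fin (p + 2) ≃ {v // c v = false} := (Fintype.equivFinOfCardEq (hm.symm.trans hp)).symm
  let φ : Unit ⊕ (Fin (p + 2) × Bool) → V := fun s =>
    match s with
    | Sum.inl _ => u
    | Sum.inr (i, false) => (e i).1
    | Sum.inr (i, true) => g (e i)
  have hyu : ∀ i, (e i).1 ≠ u := by
    intro i h; have := (e i).2; rw [h, hcu] at this; simp at this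
  have hyg : ∀ i j, (e i).1 ≠ g (e j) := by
    intro i j h; have := (e i).2; rw [h, hcg] at this; simp at this
  have hgg : ∀ i j, g (e i) = g (e j) → i = j := fun i j h => e.injective (hginj _ _ h)
  have hee : ∀ i j, (e i).1 = (e j).1 → i = j := fun i j h => e.injective (Subtype.ext h)
  have hφ : Function.Bijective φ := by
    constructor
    · rintro (⟨⟩ | ⟨i, _ | _⟩) (⟨⟩ | ⟨j, _ | _⟩) h
      · rfl
      · exact absurd h.symm (hyu j)
      · exact absurd h.symm (hgu _)
      · exact absurd h (hyu i)
      · rw [hee i j h]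
      · exact absurd h (hyg i j)
      · exact absurd h (hgu _)
      · exact absurd h.symm (hyg j i)
      · rw [hgg i j h]
    · intro v
      by_cases hvu : v = u
      · exact ⟨Sum.inl (), hvu.symm⟩
      · by_cases hcv : c v = false
        · refine ⟨Sum.inr (e.symm ⟨v, hcv⟩, false), ?_⟩
          show (e (e.symm _)).1 = v
          rw [e.apply_symm_apply]
        · obtain ⟨y, hy⟩ := hcx v hvu (by simpa using hcv)
          refine ⟨Sum.inr (e.symm y, true), ?_⟩
          show g (e (e.symm _)) = v
          rw [e.apply_symm_apply, hy]
  refine ⟨SimpleGraph.Iso.symm ⟨Equiv.ofBijective φ hφ, ?_⟩⟩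
  have hnt : ∀ a b, c a = true → c b = true → ¬ T.Adj a b := by
    intro a b ha hb h; exact hc _ _ h (ha.trans hb.symm)
  have hnf : ∀ a b, c a = false → c b = false → ¬ T.Adj a b := by
    intro a b ha hb h; exact hc _ _ h (ha.trans hb.symm)
  have hadj : ∀ i j, T.Adj (e i) (g (e j)) ↔ i = j := by
    intro i j
    rw [hg]
    constructor
    · rintro (h | h)
      · exact absurd h (hgu _)
      · exact (hgg _ _ h).symm
    · rintro rfl; exact Or.inr rfl
  have hue : ∀ i, T.Adj u (e i) := fun i => hu _ (e i).2
  rintro (⟨⟩ | ⟨i, _ | _⟩) (⟨⟩ | ⟨j, _ | _⟩)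
  · simp [spider, φ]
  · simp [spider, φ, hue]
  · simp [spider, φ, hnt _ _ hcu (hcg _)]
  · simp [spider, φ, (hue _).symm]
  · simp [spider, φ, hnf _ _ (e i).2 (e j).2]
  · simp [spider, φ, hadj]
  · simp [spider, φ, hnt _ _ (hcg _) hcu]
  · simp [spider, φ, T.adj_comm (g _), hadj]
  · simp [spider, φ, hnt _ _ (hcg _) (hcg _)]

theorem stmt17 {V : Type*} [Fintype V] (T : SimpleGraph V) (hT : T.IsTree)
    (hnull : gNullity T = 1)
    (hgap : ∀ x ∈ (gCharpoly T).roots, ¬ ((0 < x ∧ x < 1) ∨ (1 < x ∧ x < 2))) :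
    Fintype.card V = 1 ∨ ∃ p : ℕ, 1 ≤ p ∧ Nonempty (T ≃g spider p) := by
  letI i1 : DecidableEq V := Classical.decEq V
  letI i2 : DecidableRel T.Adj := Classical.decRel T.Adj
  haveI : Nonempty V := hT.connected.nonempty
  rcases subsingleton_or_nontrivial V with hs | hnt
  · left
    exact le_antisymm (Fintype.card_le_one_iff_subsingleton.2 hs) Fintype.card_pos
  right
  have hev : ∀ (μ : ℝ) (f : V → ℝ), f ≠ 0 → (T.adjMatrix ℝ).mulVec f = μ • f →
      ¬ ((0 < μ ∧ μ < 1) ∨ (1 < μ ∧ μ < 2)) := by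
    intro μ f hf h
    exact hgap μ (aux_mem_roots (T.adjMatrix ℝ) μ f hf h)
  have hker : Module.finrank ℝ (LinearMap.ker (T.adjMatrix ℝ).mulVecLin) = 1 := hnull
  obtain ⟨⟨z, hAz⟩, hz, huniq⟩ := finrank_eq_one_iff'.1 hker
  have hz : z ≠ 0 := fun h => hz (Subtype.ext h)
  have hAz : (T.adjMatrix ℝ).mulVec z = 0 := hAz
  have huniq : ∀ f, (T.adjMatrix ℝ).mulVec f = 0 → ∃ a : ℝ, f = a • z := by
    intro f hf
    obtain ⟨a, ha⟩ := huniq ⟨f, hf⟩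
    exact ⟨a, (congrArg Subtype.val ha).symm⟩
  -- a two-colouring and the associated signing
  let k := hT.coloringTwo
  have hflip : ∀ f : V → ℝ, (T.adjMatrix ℝ).mulVec (fun v => if k v = 0 then f v else - f v) =
      fun v => if k v = 0 then - (T.adjMatrix ℝ).mulVec f v else (T.adjMatrix ℝ).mulVec f v := by
    intro f
    funext v
    simp only [SimpleGraph.adjMatrix_mulVec_apply]
    by_cases hv : k v = 0
    · rw [if_pos hv, ← Finset.sum_neg_distrib]
      refine Finset.sum_congr rfl fun w hw => ?_
      have hw : T.Adj v w := by simpa using hw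
      have := k.valid hw
      rw [if_neg (by rw [hv] at this; exact this.symm)]
    · rw [if_neg hv]
      refine Finset.sum_congr rfl fun w hw => ?_
      have hw : T.Adj v w := by simpa using hw
      have := k.valid hw
      rw [if_pos (by omega)]
  have hev2 : ∀ (μ : ℝ) (f : V → ℝ), f ≠ 0 → (T.adjMatrix ℝ).mulVec f = μ • f →
      μ = 0 ∨ 1 ≤ μ ^ 2 := by
    intro μ f hf h
    have h1 := hev μ f hf h
    have h2 := hev (-μ) (fun v => if k v = 0 then f v else - f v) (by
      intro h0
      apply hf
      funext v
      have := congrFun h0 v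
      by_cases hv : k v = 0 <;> simpa [hv] using this) (by
      rw [hflip, h]
      funext v
      by_cases hv : k v = 0 <;> simp [hv])
    by_contra hcon
    push Not at hcon
    obtain ⟨h3, h4⟩ := hcon
    rcases lt_or_gt_of_ne h3 with h5 | h5
    · exact h2 (Or.inl ⟨by linarith, by nlinarith⟩)
    · exact h1 (Or.inl ⟨h5, by nlinarith⟩)
  have key : ∀ f : V → ℝ, z ⬝ᵥ f = 0 → f ⬝ᵥ f ≤
      ((T.adjMatrix ℝ).mulVec f) ⬝ᵥ ((T.adjMatrix ℝ).mulVec f) := by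
    intro f hf
    refine aux_spectral (T.adjMatrix ℝ) ?_ hev2 f ?_
    · rw [Matrix.IsHermitian, Matrix.conjTranspose_eq_transpose_of_trivial,
        SimpleGraph.transpose_adjMatrix]
    · intro g hg
      obtain ⟨a, rfl⟩ := huniq g hg
      rw [smul_dotProduct, hf, smul_zero]
  -- choose the colour class supporting the kernel
  obtain ⟨c, hc, hzc⟩ : ∃ c : V → Bool, (∀ a b, T.Adj a b → c a ≠ c b) ∧
      ∀ v, c v = false → z v = 0 := by
    obtain ⟨a, ha⟩ := huniq (fun v => if k v = 0 then z v else - z v) (by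
      rw [hflip, hAz]; funext v; simp)
    have ha' : ∀ v, (if k v = 0 then z v else - z v) = a * z v := fun v => congrFun ha v
    by_cases ha1 : a = 1
    · refine ⟨fun v => decide (k v = 0), ?_, ?_⟩
      · intro v w hvw h
        have := k.valid hvw
        simp only [decide_eq_decide] at h
        omega
      · intro v hv
        have := ha' v
        rw [if_neg (by simpa using hv), ha1] at this
        linarith
    · refine ⟨fun v => decide (k v ≠ 0), ?_, ?_⟩
      · intro v w hvw h
        have := k.valid hvw
        simp only [decide_eq_decide] at h
        omega
      · intro v hv
        have := ha' v
        rw [if_pos (by simpa using hv)] at this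
        have h2 : (a - 1) * z v = 0 := by linarith
        rcases mul_eq_zero.1 h2 with h3 | h3
        · exact absurd (by linarith) ha1
        · exact h3
  obtain ⟨u, hcu, hu, hdeg2, hcard⟩ := aux_struct T hT c hc z hz hAz hzc huniq key
  exact aux_iso T hT.connected c hc
    (fun μ f hf h h' => hev μ f hf h (Or.inr h')) u hcu hu hdeg2 hcard
end
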